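/- arXiv:2001.07677 — 14 statements merged into one kernel-verified Lean document; each statement's English description precedes it below -/
import Mathlib

section
/- Let P be an n-polytope with flag set F and involutions r_0, …, r_{n−1}, and let 0 ≤ i < j ≤ n−1. Then P is (i,j)-flat if and only if for every pair of flags Φ, Ψ ∈ F there is a flag lying both in the orbit of Φ under the subgroup generated by {r_{i+1}, …, r_{n−1}} and in the ({0,…,n−1}∖{j})-orbit of Ψ. -/
/-- `SOrbit r S Φ Ψ` : the flag `Ψ` lies in the orbit of the flag `Φ` under the
subgroup generated by the involutions `r c` for `c ∈ S`. -/
def SOrbit {F : Type*} (r : ℕ → F → F) (S : Set ℕ) (Φ Ψ : F) : Prop :=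
  Relation.ReflTransGen (fun x y => ∃ i ∈ S, r i x = y) Φ Ψ

/-- Encoding of an abstract `n`-polytope on a flag set `F` with maps `r i`
(only the indices `i < n` are relevant). -/
structure IsPolytope (n : ℕ) {F : Type*} (r : ℕ → F → F) : Prop where
  nonempty : Nonempty F
  invol : ∀ i < n, ∀ Φ, r i (r i Φ) = Φ
  noFixedPoints : ∀ i < n, ∀ Φ, r i Φ ≠ Φ
  commute : ∀ i < n, ∀ j < n, i + 1 < j → ∀ Φ, r i (r j Φ) = r j (r i Φ)
  transitive : ∀ Φ Ψ, SOrbit r {c | c < n} Φ Ψ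
  pip : ∀ i j, i < j → j < n → ∀ Φ Ψ,
    SOrbit r {c | i ≤ c ∧ c < n} Φ Ψ → SOrbit r {c | c ≤ j} Φ Ψ →
    SOrbit r {c | i ≤ c ∧ c ≤ j} Φ Ψ

/-- `(i,j)`-flatness: the `({0,…,n−1} \ {i})`-orbit of any flag meets the
`({0,…,n−1} \ {j})`-orbit of any flag. -/
def IsFlat (n : ℕ) {F : Type*} (r : ℕ → F → F) (i j : ℕ) : Prop :=
  ∀ Φ Ψ : F, ∃ Λ, SOrbit r ({c | c < n} \ {i}) Φ Λ ∧ SOrbit r ({c | c < n} \ {j}) Ψ Λ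

theorem split_orbit {F : Type*} (n : ℕ) (r : ℕ → F → F)
    (hP : IsPolytope n r) (i : ℕ) (hi : i < n) (Φ Λ : F)
    (h : SOrbit r ({c | c < n} \ {i}) Φ Λ) :
    ∃ Λ', SOrbit r {c | i + 1 ≤ c ∧ c < n} Φ Λ' ∧ SOrbit r {c | c < i} Λ' Λ := by
  unfold SOrbit at h
  induction h with
  | refl => exact ⟨Φ, Relation.ReflTransGen.refl, Relation.ReflTransGen.refl⟩
  | tail _ hs ih =>
    obtain ⟨Λ', h1, h2⟩ := ih
    obtain ⟨c, ⟨hc, hci⟩, rfl⟩ := hs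
    simp only [Set.mem_ofPred_eq, Set.mem_singleton_iff] at hc hci
    rcases Nat.lt_or_gt_of_ne hci with hlt | hgt
    · exact ⟨Λ', h1, Relation.ReflTransGen.tail h2 ⟨c, hlt, rfl⟩⟩
    · refine ⟨r c Λ', Relation.ReflTransGen.tail h1 ⟨c, ⟨hgt, hc⟩, rfl⟩, ?_⟩
      refine Relation.ReflTransGen.lift (r c) ?_ _ _ h2
      rintro a b ⟨d, hd, rfl⟩
      have hd' : d < i := hd
      exact ⟨d, hd, hP.commute d (by omega) c hc (by omega) a⟩

theorem flat_iff_orbit_meets {F : Type*} (n : ℕ) (hn : 1 ≤ n) (r : ℕ → F → F)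
    (hP : IsPolytope n r) (i j : ℕ) (hij : i < j) (hj : j < n) :
    IsFlat n r i j ↔
      ∀ Φ Ψ : F, ∃ Λ, SOrbit r {c | i + 1 ≤ c ∧ c < n} Φ Λ ∧
        SOrbit r ({c | c < n} \ {j}) Ψ Λ := by
  constructor
  · intro h Φ Ψ
    obtain ⟨Λ, h1, h2⟩ := h Φ Ψ
    obtain ⟨Λ', h3, h4⟩ := split_orbit n r hP i (by omega) Φ Λ h1
    refine ⟨Λ', h3, Relation.ReflTransGen.trans h2 ?_⟩
    refine Relation.ReflTransGen.mono ?_ _ _ (Relation.ReflTransGen.swap _ _ h4)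
    rintro a b ⟨d, hd, rfl⟩
    have hd' : d < i := hd
    refine ⟨d, ⟨?_, ?_⟩, hP.invol d (by omega) b⟩
    · show d < n
      omega
    · show ¬ d = j
      omega
  · intro h Φ Ψ
    obtain ⟨Λ, h1, h2⟩ := h Φ Ψ
    refine ⟨Λ, Relation.ReflTransGen.mono ?_ _ _ h1, h2⟩
    rintro a b ⟨d, ⟨hd, hdn⟩, rfl⟩
    refine ⟨d, ⟨hdn, ?_⟩, rfl⟩
    show ¬ d = i
    omega
end

section
/- Let n ≥ 2, let P = (F, r) be a facet-bipartite n-polytope with coloring c, and let k ≥ 2 be an even integer. Then the flat extension P|k, with flag set F × ZMod k and maps R_0, …, R_n, is an (n+1)-polytope: each R_i is a fixed-point-free involution, R_i and R_j commute whenever |i − j| > 1, the group generated by R_0, …, R_n acts transitively on F × ZMod k, and the Path Intersection Property holds. Moreover P|k is (n−2,n)-flat. -/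
/-- `c` is a proper 2-coloring of the facet graph of the `n`-polytope `(F, r)`:
`c` is unchanged by `r_i` for `i ≤ n−2` and changed by `r_{n−1}`. -/
def FacetBipColoring (n : ℕ) {F : Type*} (r : ℕ → F → F) (c : F → ZMod 2) : Prop :=
  (∀ i ≤ n - 2, ∀ Φ, c (r i Φ) = c Φ) ∧ (∀ Φ, c (r (n - 1) Φ) = c Φ + 1)

/-- The maps `R_0, …, R_n` of the flat extension `P|k` of a facet-bipartite
`n`-polytope `(F, r)` with coloring `c`, where `k` is even: flags are `F × ZMod k`,
`R_i(Φ, a) = (r_i Φ, a)` for `i ≤ n−1`, and `R_n(Φ, a) = (Φ, a+1)` if the parity of `a`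
equals `c(Φ)` and `R_n(Φ, a) = (Φ, a−1)` otherwise. -/
def flatExtR (n : ℕ) {F : Type*} (r : ℕ → F → F) (c : F → ZMod 2) (k : ℕ)
    (h2 : (2 : ℕ) ∣ k) : ℕ → F × ZMod k → F × ZMod k :=
  fun i X =>
    if i < n then (r i X.1, X.2)
    else if ZMod.castHom h2 (ZMod 2) X.2 = c X.1 then (X.1, X.2 + 1) else (X.1, X.2 - 1)

theorem SOrbit.mono' {F : Type*} {r : ℕ → F → F} {S T : Set ℕ} (h : S ⊆ T) {Φ Ψ : F}
    (H : SOrbit r S Φ Ψ) : SOrbit r T Φ Ψ := by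
  induction H with
  | refl => exact Relation.ReflTransGen.refl
  | tail _ hs ih =>
    obtain ⟨i, hi, e⟩ := hs
    exact Relation.ReflTransGen.tail ih ⟨i, h hi, e⟩

/-- Orbits of `P` lift to orbits of the flat extension. -/
theorem SOrbit.lift_flatExt {F : Type*} {n : ℕ} {r : ℕ → F → F} {c : F → ZMod 2} {k : ℕ}
    {h2 : (2 : ℕ) ∣ k} {S : Set ℕ} (hS : ∀ i ∈ S, i < n) {Φ Ψ : F} (a : ZMod k)
    (H : SOrbit r S Φ Ψ) : SOrbit (flatExtR n r c k h2) S (Φ, a) (Ψ, a) := by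
  induction H with
  | refl => exact Relation.ReflTransGen.refl
  | tail _ hs ih =>
    obtain ⟨i, hi, e⟩ := hs
    refine Relation.ReflTransGen.tail ih ⟨i, hi, ?_⟩
    simp [flatExtR, hS i hi, e]

/-- Orbits of the flat extension project to orbits of `P`. -/
theorem SOrbit.proj_flatExt {F : Type*} {n : ℕ} {r : ℕ → F → F} {c : F → ZMod 2} {k : ℕ}
    {h2 : (2 : ℕ) ∣ k} {S : Set ℕ} {X Y : F × ZMod k}
    (H : SOrbit (flatExtR n r c k h2) S X Y) : SOrbit r (S ∩ {i | i < n}) X.1 Y.1 := by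
  induction H with
  | refl => exact Relation.ReflTransGen.refl
  | tail _ hs ih =>
    obtain ⟨i, hi, e⟩ := hs
    by_cases hin : i < n
    · refine Relation.ReflTransGen.tail ih ⟨i, ⟨hi, hin⟩, ?_⟩
      rw [← e]
      simp [flatExtR, hin]
    · rw [← e]
      simp only [flatExtR, hin, if_false]
      split_ifs <;> exact ih

/-- Orbits not using `R_n` keep the second coordinate. -/
theorem SOrbit.snd_flatExt {F : Type*} {n : ℕ} {r : ℕ → F → F} {c : F → ZMod 2} {k : ℕ}
    {h2 : (2 : ℕ) ∣ k} {S : Set ℕ} (hS : ∀ i ∈ S, i < n) {X Y : F × ZMod k}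
    (H : SOrbit (flatExtR n r c k h2) S X Y) : X.2 = Y.2 := by
  induction H with
  | refl => rfl
  | tail _ hs ih =>
    obtain ⟨i, hi, e⟩ := hs
    rw [← e, ih]
    simp [flatExtR, hS i hi]

theorem zmod_two_add_one {x y : ZMod 2} (h : ¬ x = y) : x = y + 1 := by
  revert x y
  decide

/-- Using only `R_{n-1}` and `R_n` every second coordinate is reachable. -/
theorem flatExt_reach {F : Type*} {n : ℕ} (hn : 2 ≤ n) {r : ℕ → F → F} {c : F → ZMod 2}
    (hc : FacetBipColoring n r c) {k : ℕ} (hk : 2 ≤ k) (h2 : (2 : ℕ) ∣ k)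
    (X : F × ZMod k) (b : ZMod k) :
    ∃ Φ, SOrbit (flatExtR n r c k h2) {n - 1, n} X (Φ, b) := by
  have key : ∀ m : ℕ, ∃ Φ, SOrbit (flatExtR n r c k h2) {n - 1, n} X (Φ, X.2 + m) := by
    intro m
    induction m with
    | zero => exact ⟨X.1, by
        rw [Nat.cast_zero, add_zero]
        exact Relation.ReflTransGen.refl⟩
    | succ m ih =>
      obtain ⟨Φ, hΦ⟩ := ih
      by_cases h : ZMod.castHom h2 (ZMod 2) (X.2 + m) = c Φ
      · refine ⟨Φ, Relation.ReflTransGen.tail hΦ ⟨n, by simp, ?_⟩⟩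
        simp only [flatExtR, lt_irrefl, if_false]
        rw [if_pos h]
        push_cast
        rw [add_assoc]
      · have h' : ZMod.castHom h2 (ZMod 2) (X.2 + m) = c (r (n - 1) Φ) := by
          rw [hc.2]
          exact zmod_two_add_one h
        refine ⟨r (n - 1) Φ, Relation.ReflTransGen.tail
          (b := (r (n - 1) Φ, X.2 + m))
          (Relation.ReflTransGen.tail hΦ ⟨n - 1, by simp, ?_⟩) ⟨n, by simp, ?_⟩⟩
        · have : n - 1 < n := by omega
          simp [flatExtR, this]
        · simp only [flatExtR, lt_irrefl, if_false]
          rw [if_pos h']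
          push_cast
          rw [add_assoc]
  have : NeZero k := ⟨by omega⟩
  obtain ⟨Φ, h⟩ := key (b - X.2).val
  refine ⟨Φ, ?_⟩
  rw [ZMod.natCast_zmod_val] at h
  simpa using h

/-- the flat extension `P|k` of a facet-bipartite `n`-polytope
(`k ≥ 2` even) is an `(n+1)`-polytope, and it is `(n−2,n)`-flat. -/
theorem flatExt_isPolytope_isFlat {F : Type*} (n : ℕ) (hn : 2 ≤ n)
    (r : ℕ → F → F) (hP : IsPolytope n r)
    (c : F → ZMod 2) (hc : FacetBipColoring n r c)
    (k : ℕ) (hk : 2 ≤ k) (h2 : (2 : ℕ) ∣ k) :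
    IsPolytope (n + 1) (flatExtR n r c k h2) ∧
      IsFlat (n + 1) (flatExtR n r c k h2) (n - 2) n := by
  have : Fact (1 < k) := ⟨by omega⟩
  refine ⟨⟨?_, ?_, ?_, ?_, ?_, ?_⟩, ?_⟩
  · obtain ⟨Φ⟩ := hP.nonempty
    exact ⟨(Φ, 0)⟩
  · rintro i - ⟨Φ, a⟩
    by_cases hi : i < n
    · simp [flatExtR, hi, hP.invol i hi]
    · by_cases h : ZMod.castHom h2 (ZMod 2) a = c Φ
      · have h' : ¬ ZMod.castHom h2 (ZMod 2) (a + 1) = c Φ := by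
          rw [map_add, map_one, h]
          simp
        simp only [flatExtR, hi, if_false, if_pos h, if_neg h']
        simp
      · have h' : ZMod.castHom h2 (ZMod 2) (a - 1) = c Φ := by
          rw [map_sub, map_one, zmod_two_add_one h]
          simp
        simp only [flatExtR, hi, if_false, if_neg h, if_pos h']
        simp
  · rintro i - ⟨Φ, a⟩ e
    by_cases hi : i < n
    · simp only [flatExtR, hi, if_true] at e
      exact hP.noFixedPoints i hi Φ (congrArg Prod.fst e)
    · simp only [flatExtR, hi, if_false] at e
      split_ifs at e
      · have := congrArg Prod.snd e
        simp at this
      · have := congrArg Prod.snd e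
        simp at this
  · rintro i - j hj hij ⟨Φ, a⟩
    have hi : i < n := by omega
    by_cases hjn : j < n
    · simp [flatExtR, hi, hjn, hP.commute i hi j hjn hij]
    · simp only [flatExtR, hi, hjn, if_false, if_true, hc.1 i (by omega)]
      split_ifs <;> rfl
  · rintro X ⟨Ψ, b⟩
    obtain ⟨Φ, h⟩ := flatExt_reach hn hc hk h2 X b
    refine Relation.ReflTransGen.trans (h.mono' ?_)
      (((hP.transitive Φ Ψ).lift_flatExt (fun i hi => hi) b).mono' ?_)
    · rintro i (rfl | rfl) <;> simp only [Set.mem_ofPred_eq] <;> omega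
    · intro i (hi : i < n)
      simp only [Set.mem_ofPred_eq]
      omega
  · rintro i j hij hj ⟨Φ, a⟩ ⟨Ψ, b⟩ H1 H2
    by_cases hjn : j < n
    · have hS : ∀ l ∈ {l | l ≤ j}, l < n := fun l hl => lt_of_le_of_lt hl hjn
      have hab : a = b := H2.snd_flatExt hS
      subst hab
      refine SOrbit.lift_flatExt (fun l hl => lt_of_le_of_lt hl.2 hjn) a
        (hP.pip i j hij hjn Φ Ψ (H1.proj_flatExt.mono' ?_) (H2.proj_flatExt.mono' ?_))
      · exact fun l hl => ⟨hl.1.1, hl.2⟩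
      · exact fun l hl => hl.1
    · refine H1.mono' ?_
      rintro l ⟨h1, h3⟩
      exact ⟨h1, by omega⟩
  · rintro X ⟨Ψ, b⟩
    obtain ⟨Φ, h⟩ := flatExt_reach hn hc hk h2 X b
    refine ⟨(Φ, b), h.mono' ?_, ((hP.transitive Ψ Φ).lift_flatExt (fun i hi => hi) b).mono' ?_⟩
    · rintro i (rfl | rfl) <;>
        simp only [Set.mem_sdiff, Set.mem_ofPred_eq, Set.mem_singleton_iff] <;> omega
    · intro i (hi : i < n)
      simp only [Set.mem_sdiff, Set.mem_ofPred_eq, Set.mem_singleton_iff]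
      omega
end

section
/- Let n ≥ 2, let P = (F, r) be a facet-bipartite n-polytope with coloring c, and let k ≥ 2 be an even integer. Then the {0,…,n−1}-orbits (with respect to R_0, …, R_{n−1}) of the flat extension P|k are exactly the k sets F × {a} for a ∈ ZMod k; in particular P|k has exactly k facets, and on each facet F × {a} the projection to F is a bijection carrying R_i to r_i for each 0 ≤ i ≤ n−1, so each facet is isomorphic to P. -/
/-- the `{0,…,n−1}`-orbits of the flat extension `P|k` are exactly the
`k` layers `F × {a}` (so `P|k` has exactly `k` facets), and on each layer the
projection to `F` carries `R_i` to `r_i` for `i ≤ n−1`, so each facet is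
isomorphic to `P`. -/
theorem flatExt_facets {F : Type*} (n : ℕ) (hn : 2 ≤ n)
    (r : ℕ → F → F) (hP : IsPolytope n r)
    (c : F → ZMod 2) (hc : FacetBipColoring n r c)
    (k : ℕ) (hk : 2 ≤ k) (h2 : (2 : ℕ) ∣ k) :
    (∀ (Φ Ψ : F) (a b : ZMod k),
        SOrbit (flatExtR n r c k h2) {c | c < n} (Φ, a) (Ψ, b) ↔ a = b) ∧
    (∀ i < n, ∀ (Φ : F) (a : ZMod k), flatExtR n r c k h2 i (Φ, a) = (r i Φ, a)) := by
  have key : ∀ i < n, ∀ (Φ : F) (a : ZMod k),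
      flatExtR n r c k h2 i (Φ, a) = (r i Φ, a) := by
    intro i hi Φ a
    simp [flatExtR, hi]
  refine ⟨?_, key⟩
  intro Φ Ψ a b
  constructor
  · intro h
    have gen : ∀ X Y : F × ZMod k,
        SOrbit (flatExtR n r c k h2) {c | c < n} X Y → X.2 = Y.2 := by
      intro X Y hXY
      unfold SOrbit at hXY
      induction hXY with
      | refl => rfl
      | tail _ hstep ih =>
        obtain ⟨i, hi, rfl⟩ := hstep
        rw [ih, key i hi]
    exact gen _ _ h
  · rintro rfl
    have h := hP.transitive Φ Ψ
    unfold SOrbit at h ⊢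
    induction h with
    | refl => exact Relation.ReflTransGen.refl
    | tail _ hstep ih =>
      obtain ⟨i, hi, rfl⟩ := hstep
      exact Relation.ReflTransGen.tail ih ⟨i, hi, key i hi _ a⟩
end

section
/- Let n ≥ 2, let P = (F, r) be a facet-bipartite n-polytope with coloring c, let k ≥ 2 be an even integer, and let φ be an automorphism of P. Then either c(φ(Λ)) = c(Λ) for all flags Λ, or c(φ(Λ)) = c(Λ) + 1 for all flags Λ. In the first case the map (Λ, a) ↦ (φ(Λ), a) is an automorphism of the flat extension P|k, and in the second case the map (Λ, a) ↦ (φ(Λ), −a) is an automorphism of P|k. In particular, every automorphism of P extends to an automorphism of P|k (P|k is hereditary). -/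
/-- An automorphism of the structure with maps `r_0, …, r_{n−1}` on flag set `F`:
a bijection commuting with each `r_i`, `i < n`. -/
def IsAuto (n : ℕ) {F : Type*} (r : ℕ → F → F) (φ : F → F) : Prop :=
  Function.Bijective φ ∧ ∀ i < n, ∀ Φ, φ (r i Φ) = r i (φ Φ)

/-- every automorphism `φ` of a facet-bipartite `n`-polytope `P` either
preserves the facet coloring or reverses it everywhere; in the first case
`(Λ, a) ↦ (φ(Λ), a)` is an automorphism of the flat extension `P|k`, and in the second
case `(Λ, a) ↦ (φ(Λ), −a)` is.  In particular `P|k` is hereditary. -/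
theorem flatExt_hereditary {F : Type*} (n : ℕ) (hn : 2 ≤ n)
    (r : ℕ → F → F) (hP : IsPolytope n r)
    (c : F → ZMod 2) (hc : FacetBipColoring n r c)
    (k : ℕ) (hk : 2 ≤ k) (h2 : (2 : ℕ) ∣ k)
    (φ : F → F) (hφ : IsAuto n r φ) :
    ((∀ Λ, c (φ Λ) = c Λ) ∨ (∀ Λ, c (φ Λ) = c Λ + 1)) ∧
    ((∀ Λ, c (φ Λ) = c Λ) →
      IsAuto (n + 1) (flatExtR n r c k h2) (fun X => (φ X.1, X.2))) ∧
    ((∀ Λ, c (φ Λ) = c Λ + 1) →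
      IsAuto (n + 1) (flatExtR n r c k h2) (fun X => (φ X.1, -X.2))) := by
  obtain ⟨⟨hinj, hsurj⟩, hcomm⟩ := hφ
  obtain ⟨hc1, hc2⟩ := hc
  have z2 : ∀ x : ZMod 2, x = 0 ∨ x = 1 := by decide
  have hneg : ∀ x y : ZMod 2, (-x = y + 1) ↔ ¬ (x = y) := by decide
  refine ⟨?_, ?_, ?_⟩
  · have step : ∀ i < n, ∀ Λ, c (φ (r i Λ)) - c (r i Λ) = c (φ Λ) - c Λ := by
      intro i hi Λ
      rw [hcomm i hi]
      by_cases h : i ≤ n - 2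
      · rw [hc1 i h, hc1 i h]
      · have : i = n - 1 := by omega
        subst this
        rw [hc2, hc2]
        ring
    obtain ⟨Φ⟩ := hP.nonempty
    have key : ∀ Λ, c (φ Λ) - c Λ = c (φ Φ) - c Φ := by
      intro Λ
      have h := hP.transitive Φ Λ
      unfold SOrbit at h
      induction h with
      | refl => rfl
      | tail _ hs ih =>
        obtain ⟨i, hi, rfl⟩ := hs
        rw [step i hi, ih]
    rcases z2 (c (φ Φ) - c Φ) with h | h
    · left
      intro Λ
      exact sub_eq_zero.mp ((key Λ).trans h)
    · right
      intro Λ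
      rw [← h, ← key Λ]
      ring
  · intro hcol
    refine ⟨⟨?_, ?_⟩, ?_⟩
    · rintro ⟨x, a⟩ ⟨y, b⟩ h
      simp only [Prod.mk.injEq] at h
      exact Prod.ext (hinj h.1) h.2
    · rintro ⟨y, b⟩
      obtain ⟨x, rfl⟩ := hsurj y
      exact ⟨(x, b), rfl⟩
    · rintro i - ⟨x, a⟩
      by_cases hi : i < n
      · simp only [flatExtR, if_pos hi, hcomm i hi]
      · simp only [flatExtR, if_neg hi, hcol]
        split_ifs <;> rfl
  · intro hcol
    refine ⟨⟨?_, ?_⟩, ?_⟩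
    · rintro ⟨x, a⟩ ⟨y, b⟩ h
      simp only [Prod.mk.injEq] at h
      exact Prod.ext (hinj h.1) (neg_injective h.2)
    · rintro ⟨y, b⟩
      obtain ⟨x, rfl⟩ := hsurj y
      exact ⟨(x, -b), by simp⟩
    · rintro i - ⟨x, a⟩
      by_cases hi : i < n
      · simp only [flatExtR, if_pos hi, hcomm i hi]
      · simp only [flatExtR, if_neg hi, hcol, map_neg, hneg]
        by_cases h : ZMod.castHom h2 (ZMod 2) a = c x
        · rw [if_pos h, if_neg (not_not.mpr h)]
          exact Prod.ext rfl (by ring)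
        · rw [if_neg h, if_pos h]
          exact Prod.ext rfl (by ring)
end

section
/- Let n ≥ 2, let P = (F, r) be a facet-bipartite n-polytope with coloring c, and let k ≥ 2 be an even integer. Then for every automorphism ψ of the flat extension P|k there exist an automorphism φ of P, a sign ε ∈ {1, −1} ⊆ ZMod k, and an element t ∈ ZMod k such that ψ(Λ, a) = (φ(Λ), ε·a + t) for all (Λ, a) ∈ F × ZMod k. -/
/-- every automorphism of the flat extension `P|k` has the form
`(Λ, a) ↦ (φ(Λ), ε·a + t)` for some automorphism `φ` of `P`, a sign `ε ∈ {1, −1}`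
in `ZMod k`, and some `t ∈ ZMod k`. -/
theorem flatExt_aut_form {F : Type*} (n : ℕ) (hn : 2 ≤ n)
    (r : ℕ → F → F) (hP : IsPolytope n r)
    (c : F → ZMod 2) (hc : FacetBipColoring n r c)
    (k : ℕ) (hk : 2 ≤ k) (h2 : (2 : ℕ) ∣ k)
    (ψ : F × ZMod k → F × ZMod k) (hψ : IsAuto (n + 1) (flatExtR n r c k h2) ψ) :
    ∃ φ : F → F, IsAuto n r φ ∧ ∃ ε t : ZMod k, (ε = 1 ∨ ε = -1) ∧
      ∀ (Λ : F) (a : ZMod k), ψ (Λ, a) = (φ Λ, ε * a + t) := by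
  obtain ⟨hbij, hcom⟩ := hψ
  have hlow : ∀ i < n, ∀ Λ a, ψ (r i Λ, a) = (r i (ψ (Λ, a)).1, (ψ (Λ, a)).2) := by
    intro i hi Λ a
    have := hcom i (by omega) (Λ, a)
    simpa [flatExtR, hi] using this
  have htop : ∀ Λ a, ψ (flatExtR n r c k h2 n (Λ, a)) = flatExtR n r c k h2 n (ψ (Λ, a)) :=
    fun Λ a => hcom n (by omega) (Λ, a)
  haveI : NeZero k := ⟨by omega⟩
  obtain ⟨Λ₀⟩ := hP.nonempty
  obtain ⟨φ, hφ⟩ : ∃ φ : F → F, ∀ Λ, φ Λ = (ψ (Λ, 0)).1 := ⟨_, fun _ => rfl⟩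
  obtain ⟨t, ht⟩ : ∃ t, t = (ψ (Λ₀, 0)).2 := ⟨_, rfl⟩
  obtain ⟨d, hd⟩ : ∃ d, d = c (φ Λ₀) - c Λ₀ := ⟨_, rfl⟩
  have hφr : ∀ i < n, ∀ Λ, φ (r i Λ) = r i (φ Λ) := by
    intro i hi Λ
    rw [hφ, hφ, hlow i hi]
  have hcr : ∀ i < n, ∀ Λ Λ', c (r i Λ) - c (r i Λ') = c Λ - c Λ' := by
    intro i hi Λ Λ'
    by_cases h : i ≤ n - 2
    · rw [hc.1 i h, hc.1 i h]
    · have : i = n - 1 := by omega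
      subst this
      rw [hc.2, hc.2]; ring
  have hbase : ∀ Λ, (ψ (Λ, 0)).2 = t ∧ c (φ Λ) - c Λ = d := by
    intro Λ
    have h := hP.transitive Λ₀ Λ
    unfold SOrbit at h
    induction h with
    | refl => exact ⟨ht.symm, hd.symm⟩
    | tail _ hs ih =>
      obtain ⟨i, hi, rfl⟩ := hs
      refine ⟨?_, ?_⟩
      · rw [hlow i hi]; exact ih.1
      · rw [hφr i hi, hcr i hi]; exact ih.2
  obtain ⟨ε, hε⟩ : ∃ ε : ZMod k, ε = if ZMod.castHom h2 (ZMod 2) t = d then 1 else -1 := ⟨_, rfl⟩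
  have hε1 : ZMod.castHom h2 (ZMod 2) ε = 1 := by
    rw [hε]; split_ifs
    · exact map_one _
    · rw [map_neg, map_one]; decide
  have main : ∀ (m : ℕ) (Λ : F), ψ (Λ, (m : ZMod k)) = (φ Λ, ε * m + t) := by
    intro m
    induction m with
    | zero =>
      intro Λ
      ext
      · simp [hφ]
      · simpa using (hbase Λ).1
    | succ m ih =>
      have key : ∀ Λ, (m : ZMod 2) = c Λ →
          ψ (Λ, ((m + 1 : ℕ) : ZMod k)) = (φ Λ, ε * ((m + 1 : ℕ) : ZMod k) + t) := by
        intro Λ hΛ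
        have h := htop Λ m
        rw [ih] at h
        have e1 : ZMod.castHom h2 (ZMod 2) (m : ZMod k) = c Λ := by
          rw [map_natCast]; exact hΛ
        have e2 : ZMod.castHom h2 (ZMod 2) (ε * m + t) = c (φ Λ) ↔
            ZMod.castHom h2 (ZMod 2) t = d := by
          rw [map_add, map_mul, hε1, map_natCast, ← (hbase Λ).2, hΛ, one_mul, eq_sub_iff_add_eq,
            add_comm]
        simp only [flatExtR, lt_irrefl, if_false] at h
        rw [if_pos e1] at h
        push_cast
        rw [h]
        by_cases h3 : ZMod.castHom h2 (ZMod 2) t = d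
        · rw [if_pos (e2.2 h3)]
          rw [if_pos h3] at hε
          rw [hε]; congr 1; ring
        · rw [if_neg (fun h => h3 (e2.1 h))]
          rw [if_neg h3] at hε
          rw [hε]; congr 1; ring
      intro Λ
      by_cases hΛ : (m : ZMod 2) = c Λ
      · exact key Λ hΛ
      · have hn1 : n - 1 < n := by omega
        have h4 : (m : ZMod 2) = c (r (n - 1) Λ) := by
          rw [hc.2]
          have h7 : ∀ x y : ZMod 2, ¬ x = y → x = y + 1 := by decide
          exact h7 _ _ hΛ
        have h5 := key _ h4
        rw [hlow _ hn1, hφr _ hn1, Prod.mk.injEq] at h5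
        have h6 := congrArg (r (n - 1)) h5.1
        rw [hP.invol _ hn1, hP.invol _ hn1] at h6
        exact Prod.ext h6 h5.2
  have main' : ∀ (Λ : F) (a : ZMod k), ψ (Λ, a) = (φ Λ, ε * a + t) := by
    intro Λ a
    have := main a.val Λ
    rwa [ZMod.natCast_zmod_val] at this
  refine ⟨φ, ⟨⟨?_, ?_⟩, hφr⟩, ε, t, ?_, main'⟩
  · intro x y hxy
    have : ψ (x, 0) = ψ (y, 0) := by rw [main', main', hxy]
    exact congrArg Prod.fst (hbij.1 this)
  · intro y
    obtain ⟨⟨x, a⟩, hx⟩ := hbij.2 (y, 0)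
    rw [main'] at hx
    exact ⟨x, congrArg Prod.fst hx⟩
  · rw [hε]; split_ifs
    · exact Or.inl rfl
    · exact Or.inr rfl
end

section
/- Let n ≥ 2, let P = (F, r) be a facet-bipartite n-polytope with coloring c, and let k ≥ 2 be an even integer. Then the maps α(Λ, a) = (Λ, 1 − a) and β(Λ, a) = (Λ, 3 − a) are automorphisms of the flat extension P|k, and the subgroup of Γ(P|k) generated by α and β acts transitively on the layers: for all Λ ∈ F and all a, b ∈ ZMod k, there is γ ∈ ⟨α, β⟩ with γ(Λ, a) = (Λ, b). -/
theorem flatExt_refl_isAuto {F : Type*} (n : ℕ) (r : ℕ → F → F) (c : F → ZMod 2)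
    (k : ℕ) (h2 : (2 : ℕ) ∣ k) (s : ZMod k) (hs : ZMod.castHom h2 (ZMod 2) s = 1) :
    IsAuto (n + 1) (flatExtR n r c k h2) (fun X : F × ZMod k => (X.1, s - X.2)) := by
  have hinv : Function.Involutive (fun X : F × ZMod k => (X.1, s - X.2)) := by
    intro X
    simp
  refine ⟨hinv.bijective, ?_⟩
  rintro i - ⟨x, a⟩
  unfold flatExtR
  by_cases hi : i < n
  · simp only [hi, if_true]
  · simp only [hi, if_false, map_sub, hs]
    have key : ∀ u v : ZMod 2, (1 - u = v) ↔ ¬ (u = v) := by decide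
    by_cases h : ZMod.castHom h2 (ZMod 2) a = c x
    · have h' : ¬ (1 - ZMod.castHom h2 (ZMod 2) a = c x) := fun h3 => (key _ _).1 h3 h
      rw [if_pos h, if_neg h']
      ext
      · rfl
      · dsimp only
        ring
    · have h' : 1 - ZMod.castHom h2 (ZMod 2) a = c x := (key _ _).2 h
      rw [if_neg h, if_pos h']
      ext
      · rfl
      · dsimp only
        ring

theorem flatExt_reach_even {F : Type*} (k : ℕ) (Λ : F) (a : ZMod k) (m : ℕ) :
    Relation.ReflTransGen
      (fun X Y : F × ZMod k => (X.1, 1 - X.2) = Y ∨ (X.1, 3 - X.2) = Y)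
      (Λ, a) (Λ, a + 2 * (m : ZMod k)) := by
  induction m with
  | zero => simpa using Relation.ReflTransGen.refl
  | succ m ih =>
    refine (ih.tail (Or.inl rfl)).tail (Or.inr ?_)
    ext
    · rfl
    · push_cast
      ring

/-- the maps `α(Λ, a) = (Λ, 1 − a)` and `β(Λ, a) = (Λ, 3 − a)` are
automorphisms of the flat extension `P|k`, and the subgroup they generate acts
transitively on the layers: any `(Λ, a)` can be carried to `(Λ, b)` by a word in
`α` and `β` (both are involutions, so reachability is exactly membership of
`(Λ, b)` in the `⟨α, β⟩`-orbit of `(Λ, a)`). -/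
theorem flatExt_layer_transitive {F : Type*} (n : ℕ) (hn : 2 ≤ n)
    (r : ℕ → F → F) (hP : IsPolytope n r)
    (c : F → ZMod 2) (hc : FacetBipColoring n r c)
    (k : ℕ) (hk : 2 ≤ k) (h2 : (2 : ℕ) ∣ k) :
    IsAuto (n + 1) (flatExtR n r c k h2) (fun X : F × ZMod k => (X.1, 1 - X.2)) ∧
    IsAuto (n + 1) (flatExtR n r c k h2) (fun X : F × ZMod k => (X.1, 3 - X.2)) ∧
    (∀ (Λ : F) (a b : ZMod k),
      Relation.ReflTransGen
        (fun X Y : F × ZMod k => (X.1, 1 - X.2) = Y ∨ (X.1, 3 - X.2) = Y)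
        (Λ, a) (Λ, b)) := by
  refine ⟨flatExt_refl_isAuto n r c k h2 1 (map_one _), flatExt_refl_isAuto n r c k h2 3 ?_, ?_⟩
  · rw [map_ofNat]
    decide
  · intro Λ a b
    have : NeZero k := ⟨by omega⟩
    obtain ⟨j, hj⟩ := ZMod.natCast_zmod_surjective (b - a)
    obtain ⟨p, hp⟩ := ZMod.natCast_zmod_surjective a
    have hb : b = a + (j : ZMod k) := by rw [hj]; ring
    rcases Nat.even_or_odd' j with ⟨m, hm | hm⟩
    · have h := flatExt_reach_even k Λ a m
      rw [hb, hm]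
      push_cast
      exact h
    · have h := flatExt_reach_even k Λ (1 - a) (m + p)
      have e : b = 1 - a + 2 * ((m + p : ℕ) : ZMod k) := by
        rw [hb, hm]
        push_cast
        rw [hp]
        ring
      rw [e]
      exact Relation.ReflTransGen.head (Or.inl rfl) h
end

section
/- Let n ≥ 2, let P = (F, r) be a facet-bipartite n-polytope with coloring c, and let k ≥ 2 be an even integer. Then the automorphism group of the flat extension P|k acts transitively on F × ZMod k if and only if the automorphism group of P acts transitively on F; that is, P|k is regular if and only if P is regular. -/
theorem auto_color_diff {F : Type*} (n : ℕ) (hn : 2 ≤ n)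
    (r : ℕ → F → F) (hP : IsPolytope n r)
    (c : F → ZMod 2) (hc : FacetBipColoring n r c) (φ : F → F) (hφ : IsAuto n r φ)
    (Φ Λ : F) : c (φ Λ) = c Λ + (c (φ Φ) - c Φ) := by
  have h := hP.transitive Φ Λ
  unfold SOrbit at h
  induction h with
  | refl => ring
  | tail _ hs ih =>
    obtain ⟨i, hi, rfl⟩ := hs
    have hi' : i < n := hi
    rw [hφ.2 i hi']
    by_cases h : i ≤ n - 2
    · rw [hc.1 i h, hc.1 i h, ih]
    · have : i = n - 1 := by omega
      subst this
      rw [hc.2, hc.2, ih]; ring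

/-- the flat extension `P|k` is regular (its automorphism group acts
transitively on `F × ZMod k`) if and only if `P` is regular. -/
theorem flatExt_regular_iff {F : Type*} (n : ℕ) (hn : 2 ≤ n)
    (r : ℕ → F → F) (hP : IsPolytope n r)
    (c : F → ZMod 2) (hc : FacetBipColoring n r c)
    (k : ℕ) (hk : 2 ≤ k) (h2 : (2 : ℕ) ∣ k) :
    (∀ X Y : F × ZMod k,
        ∃ ψ, IsAuto (n + 1) (flatExtR n r c k h2) ψ ∧ ψ X = Y) ↔
    (∀ Φ Ψ : F, ∃ φ, IsAuto n r φ ∧ φ Φ = Ψ) := by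
  constructor
  · intro H Φ Ψ
    obtain ⟨ψ, ⟨hbij, hcomm⟩, hψ⟩ := H (Φ, 0) (Ψ, 0)
    have hR : ∀ i < n, ∀ Λ : F, ∀ a, flatExtR n r c k h2 i (Λ, a) = (r i Λ, a) := by
      intro i hi Λ a
      simp [flatExtR, hi]
    have hcm : ∀ i < n, ∀ Λ : F, ψ (r i Λ, 0) = (r i (ψ (Λ, 0)).1, (ψ (Λ, 0)).2) := by
      intro i hi Λ
      rw [← hR i hi, hcomm i (by omega), ← hR i hi]
    have hz : ∀ Λ, (ψ (Λ, 0)).2 = 0 := by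
      intro Λ
      have h := hP.transitive Φ Λ
      unfold SOrbit at h
      induction h with
      | refl => rw [hψ]
      | tail _ hs ih =>
        obtain ⟨i, hi, rfl⟩ := hs
        rw [hcm i hi]; exact ih
    refine ⟨fun Λ => (ψ (Λ, 0)).1, ⟨⟨?_, ?_⟩, ?_⟩, by simp [hψ]⟩
    · intro A B hAB
      have : ψ (A, 0) = ψ (B, 0) := Prod.ext hAB (by rw [hz, hz])
      exact congrArg Prod.fst (hbij.1 this)
    · intro Λ
      have h := hP.transitive Ψ Λ
      unfold SOrbit at h
      induction h with
      | refl => exact ⟨Φ, by simp [hψ]⟩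
      | tail _ hs ih =>
        obtain ⟨i, hi, rfl⟩ := hs
        obtain ⟨B, rfl⟩ := ih
        exact ⟨r i B, by simp [hcm i hi]⟩
    · intro i hi Λ
      simp [hcm i hi]
  · rintro H ⟨Φ, a⟩ ⟨Ψ, b⟩
    obtain ⟨φ, hφ, rfl⟩ := H Φ Ψ
    have hd := auto_color_diff n hn r hP c hc φ hφ Φ
    generalize c (φ Φ) - c Φ = d at hd
    set p := ZMod.castHom h2 (ZMod 2) with hp
    have key : ∃ e : ZMod k, e * e = 1 ∧
        ((e = 1 ∧ p b - p a = d) ∨ (e = -1 ∧ p b - p a = d + 1)) := by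
      have h01 : ∀ u v : ZMod 2, u = v ∨ u = v + 1 := by decide
      rcases h01 (p b - p a) d with h | h
      · exact ⟨1, by ring, Or.inl ⟨rfl, h⟩⟩
      · exact ⟨-1, by ring, Or.inr ⟨rfl, h⟩⟩
    obtain ⟨e, he, hcase⟩ := key
    refine ⟨fun X => (φ X.1, b + e * (X.2 - a)), ⟨⟨?_, ?_⟩, ?_⟩, by simp⟩
    · rintro ⟨A, x⟩ ⟨B, y⟩ hXY
      simp only [Prod.mk.injEq] at hXY
      obtain ⟨h1, h3⟩ := hXY
      refine Prod.ext (hφ.1.1 h1) ?_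
      change x = y
      linear_combination e * h3 - (x - y) * he
    · rintro ⟨A, x⟩
      obtain ⟨B, rfl⟩ := hφ.1.2 A
      refine ⟨(B, a + e * (x - b)), Prod.ext rfl ?_⟩
      change b + e * (a + e * (x - b) - a) = x
      linear_combination (x - b) * he
    · rintro i hi ⟨Λ, x⟩
      by_cases hin : i < n
      · simp [flatExtR, hin, hφ.2 i hin]
      · simp only [flatExtR, hin, if_false, ← hp]
        have hdL := hd Λ
        have h3 : ∀ u v w t s : ZMod 2, v - w = t → (v + (u - w) = s + t ↔ u = s) := by decide
        have h4 : ∀ u v w t s : ZMod 2, v - w = t + 1 →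
          (v + -(u - w) = s + t ↔ ¬ u = s) := by decide
        rcases hcase with ⟨rfl, hab⟩ | ⟨rfl, hab⟩
        · have hiff : p (b + 1 * (x - a)) = c (φ Λ) ↔ p x = c Λ := by
            rw [hdL, one_mul, map_add, map_sub]; exact h3 _ _ _ _ _ hab
          by_cases hx : p x = c Λ
          · rw [if_pos hx, if_pos (hiff.2 hx)]
            exact Prod.ext rfl (by ring)
          · rw [if_neg hx, if_neg (fun h => hx (hiff.1 h))]
            exact Prod.ext rfl (by ring)
        · have hiff : p (b + -1 * (x - a)) = c (φ Λ) ↔ ¬ p x = c Λ := by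
            rw [hdL, neg_one_mul, map_add, map_neg, map_sub]; exact h4 _ _ _ _ _ hab
          by_cases hx : p x = c Λ
          · rw [if_pos hx, if_neg (fun h => (hiff.1 h) hx)]
            exact Prod.ext rfl (by ring)
          · rw [if_neg hx, if_pos (hiff.2 hx)]
            exact Prod.ext rfl (by ring)
end

section
/- Let n ≥ 2, let P = (F, r) be a facet-bipartite n-polytope with coloring c, and let k₁ and k₂ be even positive integers with k₁ dividing k₂. Then the map (Φ, a) ↦ (Φ, a mod k₁) from F × ZMod k₂ to F × ZMod k₁ (using the natural ring homomorphism ZMod k₂ → ZMod k₁) is surjective and commutes with the maps R_i of P|k₂ and P|k₁ for all 0 ≤ i ≤ n; that is, P|k₂ covers P|k₁. In particular, P|k covers the trivial extension P|2 for every even k ≥ 2. -/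
/-- if `k₁ ∣ k₂` are even positive integers, then the map
`(Φ, a) ↦ (Φ, a mod k₁)` is a surjection from `F × ZMod k₂` to `F × ZMod k₁`
commuting with the maps `R_i` of `P|k₂` and `P|k₁` for all `0 ≤ i ≤ n`; that is,
`P|k₂` covers `P|k₁` (in particular, `P|k` covers the trivial extension `P|2`). -/
theorem flatExt_covers_divisor {F : Type*} (n : ℕ) (hn : 2 ≤ n)
    (r : ℕ → F → F) (hP : IsPolytope n r)
    (c : F → ZMod 2) (hc : FacetBipColoring n r c)
    (k₁ k₂ : ℕ) (hk₁ : 0 < k₁) (he₁ : (2 : ℕ) ∣ k₁) (hk₂ : 0 < k₂) (he₂ : (2 : ℕ) ∣ k₂)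
    (hdvd : k₁ ∣ k₂) :
    Function.Surjective
      (fun X : F × ZMod k₂ => ((X.1, ZMod.castHom hdvd (ZMod k₁) X.2) : F × ZMod k₁)) ∧
    (∀ i < n + 1, ∀ X : F × ZMod k₂,
      ((( flatExtR n r c k₂ he₂ i X).1,
          ZMod.castHom hdvd (ZMod k₁) (flatExtR n r c k₂ he₂ i X).2) : F × ZMod k₁)
        = flatExtR n r c k₁ he₁ i (X.1, ZMod.castHom hdvd (ZMod k₁) X.2)) := by
  refine ⟨?_, ?_⟩
  · rintro ⟨Φ, a⟩
    obtain ⟨b, hb⟩ := ZMod.castHom_surjective hdvd a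
    exact ⟨(Φ, b), Prod.ext rfl hb⟩
  · rintro i _ ⟨Φ, a⟩
    have key : ZMod.castHom he₁ (ZMod 2) (ZMod.castHom hdvd (ZMod k₁) a)
        = ZMod.castHom he₂ (ZMod 2) a := by
      rw [← RingHom.comp_apply]
      exact congrArg (fun f : ZMod k₂ →+* ZMod 2 => f a) (Subsingleton.elim _ _)
    unfold flatExtR
    by_cases hi : i < n
    · simp only [if_pos hi]
    · simp only [if_neg hi, key]
      split_ifs
      · simp only [map_add, map_one]
      · simp only [map_sub, map_one]
end

section
/- Let n ≥ 2, let k ≥ 4 be an even integer, and let P = (F, r) be an n-polytope equipped with a proper facet coloring μ : F → Fin (k−1), i.e. μ(r_i(Φ)) = μ(Φ) for all 0 ≤ i ≤ n−2 and μ(r_{n−1}(Φ)) ≠ μ(Φ), for all flags Φ. Suppose σ assigns to each color c ∈ Fin (k−1) a fixed-point-free involution σ_c of Fin k such that for all distinct c, d ∈ Fin (k−1) the subgroup generated by σ_c and σ_d acts transitively on Fin k (a perfect 1-factorization condition). Then the structure with flag set F × Fin k and maps R_i(Φ, x) = (r_i(Φ), x) for 0 ≤ i ≤ n−1 and R_n(Φ,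 x) = (Φ, σ_{μ(Φ)}(x)) is an (n+1)-polytope (each R_i is a fixed-point-free involution, R_i and R_j commute whenever |i − j| > 1, the generated group acts transitively on F × Fin k, and the Path Intersection Property holds), and it is (n−2,n)-flat. -/
/-- The maps `R_0, …, R_n` of the flat extension of an `n`-polytope `(F, r)` built from
a proper facet coloring `μ : F → Fin (k−1)` and a family `σ` of matchings of the `k`
layers: flags are `F × Fin k`, `R_i(Φ, x) = (r_i Φ, x)` for `i ≤ n−1`, and
`R_n(Φ, x) = (Φ, σ_{μ(Φ)}(x))`. -/
def pfExtR (n : ℕ) {F : Type*} (r : ℕ → F → F) (k : ℕ)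
    (μ : F → Fin (k - 1)) (σ : Fin (k - 1) → Fin k → Fin k) :
    ℕ → F × Fin k → F × Fin k :=
  fun i X => if i < n then (r i X.1, X.2) else (X.1, σ (μ X.1) X.2)

theorem pfAux_lift {F : Type*} (n : ℕ) (r : ℕ → F → F) (k : ℕ)
    (μ : F → Fin (k - 1)) (σ : Fin (k - 1) → Fin k → Fin k) (S T : Set ℕ)
    (hS : ∀ c ∈ S, c < n) (hST : S ⊆ T) (x : Fin k) {Φ Ψ : F} (h : SOrbit r S Φ Ψ) :
    SOrbit (pfExtR n r k μ σ) T (Φ, x) (Ψ, x) := by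
  unfold SOrbit at *
  induction h with
  | refl => exact .refl
  | tail _ h ih =>
    obtain ⟨i, hi, rfl⟩ := h
    exact ih.tail ⟨i, hST hi, by simp [pfExtR, hS i hi]⟩

theorem pfAux_proj {F : Type*} (n : ℕ) (r : ℕ → F → F) (k : ℕ)
    (μ : F → Fin (k - 1)) (σ : Fin (k - 1) → Fin k → Fin k) (S T : Set ℕ)
    (hST : ∀ c ∈ S, c < n → c ∈ T) {X Y : F × Fin k}
    (h : SOrbit (pfExtR n r k μ σ) S X Y) : SOrbit r T X.1 Y.1 := by
  unfold SOrbit at *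
  induction h with
  | refl => exact .refl
  | tail _ h ih =>
    obtain ⟨i, hi, rfl⟩ := h
    by_cases hin : i < n
    · exact ih.tail ⟨i, hST i hi hin, by simp [pfExtR, hin]⟩
    · simpa [pfExtR, hin] using ih

theorem pfAux_layer {F : Type*} (n : ℕ) (r : ℕ → F → F) (k : ℕ)
    (μ : F → Fin (k - 1)) (σ : Fin (k - 1) → Fin k → Fin k) (S : Set ℕ)
    (hS : ∀ c ∈ S, c < n) {X Y : F × Fin k}
    (h : SOrbit (pfExtR n r k μ σ) S X Y) : X.2 = Y.2 := by
  unfold SOrbit at *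
  induction h with
  | refl => rfl
  | tail _ h ih =>
    obtain ⟨i, hi, rfl⟩ := h
    simpa [pfExtR, hS i hi] using ih

theorem pfAux_fibre {F : Type*} (n : ℕ) (hn : 2 ≤ n) (k : ℕ)
    (r : ℕ → F → F) (hP : IsPolytope n r)
    (μ : F → Fin (k - 1))
    (hμ₂ : ∀ Φ, μ (r (n - 1) Φ) ≠ μ Φ)
    (σ : Fin (k - 1) → Fin k → Fin k)
    (hσperf : ∀ c d : Fin (k - 1), c ≠ d → ∀ x y : Fin k,
      Relation.ReflTransGen (fun u v => σ c u = v ∨ σ d u = v) x y)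
    (S : Set ℕ) (h1 : n - 1 ∈ S) (h2 : n ∈ S) (Φ : F) (x y : Fin k) :
    SOrbit (pfExtR n r k μ σ) S (Φ, x) (Φ, y) := by
  have hlt : n - 1 < n := by omega
  have h := hσperf _ _ (hμ₂ Φ) x y
  unfold SOrbit
  induction h with
  | refl => exact .refl
  | @tail u v _ h ih =>
    rcases h with h | h
    · refine ((ih.tail (c := (r (n-1) Φ, u)) ⟨n-1, h1, ?_⟩).tail
        (c := (r (n-1) Φ, v)) ⟨n, h2, ?_⟩).tail ⟨n-1, h1, ?_⟩
      · simp [pfExtR, hlt]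
      · simp [pfExtR, h]
      · simp [pfExtR, hlt, hP.invol (n-1) hlt]
    · exact ih.tail ⟨n, h2, by simp [pfExtR, h]⟩

/-- let `k ≥ 4` be even, `P` an `n`-polytope with a proper facet
coloring `μ : F → Fin (k−1)`, and `σ` a perfect 1-factorization of `K_k`: each `σ_c`
is a fixed-point-free involution of `Fin k` and any two distinct `σ_c, σ_d` generate a
group acting transitively on `Fin k`.  Then the structure on `F × Fin k` with maps
`R_i(Φ, x) = (r_i Φ, x)` for `i ≤ n−1` and `R_n(Φ, x) = (Φ, σ_{μ(Φ)}(x))` is an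
`(n+1)`-polytope, and it is `(n−2, n)`-flat. -/
theorem pfExt_isPolytope_isFlat {F : Type*} (n : ℕ) (hn : 2 ≤ n)
    (k : ℕ) (hk : 4 ≤ k) (hke : Even k)
    (r : ℕ → F → F) (hP : IsPolytope n r)
    (μ : F → Fin (k - 1))
    (hμ₁ : ∀ i ≤ n - 2, ∀ Φ, μ (r i Φ) = μ Φ)
    (hμ₂ : ∀ Φ, μ (r (n - 1) Φ) ≠ μ Φ)
    (σ : Fin (k - 1) → Fin k → Fin k)
    (hσinv : ∀ c x, σ c (σ c x) = x)
    (hσnofix : ∀ c x, σ c x ≠ x)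
    (hσperf : ∀ c d : Fin (k - 1), c ≠ d → ∀ x y : Fin k,
      Relation.ReflTransGen (fun u v => σ c u = v ∨ σ d u = v) x y) :
    IsPolytope (n + 1) (pfExtR n r k μ σ) ∧
      IsFlat (n + 1) (pfExtR n r k μ σ) (n - 2) n := by
  have fib := pfAux_fibre n hn k r hP μ hμ₂ σ hσperf
  refine ⟨⟨?_, ?_, ?_, ?_, ?_, ?_⟩, ?_⟩
  · obtain ⟨Φ⟩ := hP.nonempty
    exact ⟨(Φ, ⟨0, by omega⟩)⟩
  · rintro i hi ⟨Φ, x⟩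
    by_cases h : i < n
    · simp [pfExtR, h, hP.invol i h]
    · simp [pfExtR, h, hσinv]
  · rintro i hi ⟨Φ, x⟩
    by_cases h : i < n
    · simp [pfExtR, h, hP.noFixedPoints i h]
    · simp [pfExtR, h, hσnofix]
  · rintro i hi j hj hij ⟨Φ, x⟩
    have h : i < n := by omega
    by_cases h' : j < n
    · simp [pfExtR, h, h', hP.commute i h j h' hij]
    · simp [pfExtR, h, h', hμ₁ i (by omega)]
  · rintro ⟨Φ, x⟩ ⟨Ψ, y⟩
    exact (fib _ (by simp) (by simp) Φ x y).trans
      (pfAux_lift n r k μ σ {c | c < n} _ (fun _ h => h)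
        (fun c (h : c < n) => Nat.lt_succ_of_lt h) y (hP.transitive Φ Ψ))
  · rintro i j hij hj ⟨Φ, x⟩ ⟨Ψ, y⟩ ha hb
    by_cases h : j < n
    · have hxy : x = y := pfAux_layer n r k μ σ _
        (fun c (hc : c ≤ j) => lt_of_le_of_lt hc h) hb
      subst hxy
      have ha' := pfAux_proj n r k μ σ _ {c | i ≤ c ∧ c < n} (fun c hc h => ⟨hc.1, h⟩) ha
      have hb' := pfAux_proj n r k μ σ _ {c | c ≤ j} (fun c hc _ => hc) hb
      exact pfAux_lift n r k μ σ _ _ (fun c hc => lt_of_le_of_lt hc.2 h) subset_rfl x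
        (hP.pip i j hij h Φ Ψ ha' hb')
    · have : {c | i ≤ c ∧ c ≤ j} = {c | i ≤ c ∧ c < n + 1} := by
        ext c; simp only [Set.mem_ofPred_eq]; omega
      rw [this]; exact ha
  · rintro ⟨Φ, x⟩ ⟨Ψ, y⟩
    refine ⟨(Φ, y), fib _ ?_ ?_ Φ x y, ?_⟩
    · simp only [Set.mem_sdiff, Set.mem_ofPred_eq, Set.mem_singleton_iff]; omega
    · simp only [Set.mem_sdiff, Set.mem_ofPred_eq, Set.mem_singleton_iff]; omega
    · refine pfAux_lift n r k μ σ {c | c < n} _ (fun _ h => h) ?_ y (hP.transitive Ψ Φ)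
      intro c hc
      simp only [Set.mem_sdiff, Set.mem_ofPred_eq, Set.mem_singleton_iff] at *; omega
end

section
/- Let n, m ≥ 2, let P = (F, r) be an n-polytope with base flag Φ₀ and let Q = (G, s) be an m-polytope with base flag Ψ₀, and let M ⊆ F × G be the orbit of (Φ₀, Ψ₀) under the group generated by the maps R_0, …, R_{m+n−2} of the mix construction. Then the following are equivalent: (a) for every element X of M, the projection to F restricted to the orbit of X under the subgroup generated by {R_0, …, R_{n−1}} is a bijection onto F; (b) P is facet-bipartite, i.e. there is c : F → ZMod 2 with c(r_i Λ) = c(Λ) for 0 ≤ i ≤ n−2 and c(r_{n−1} Λ) = c(Λ) + 1 for all Λ. -/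
/-- The maps `R_0, …, R_{m+n−2}` of the mix construction on `F × G`
(here `n` is the rank of the first factor):
`R_i(Λ, Δ) = (r_i Λ, Δ)` for `i ≤ n−2`, `R_{n−1}(Λ, Δ) = (r_{n−1} Λ, s_0 Δ)`, and
`R_i(Λ, Δ) = (Λ, s_{i−n+1} Δ)` for `i ≥ n`. -/
def mixR {F G : Type*} (n : ℕ) (r : ℕ → F → F) (s : ℕ → G → G) :
    ℕ → F × G → F × G :=
  fun i X =>
    if i < n - 1 then (r i X.1, X.2)
    else if i = n - 1 then (r (n - 1) X.1, s 0 X.2)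
    else (X.1, s (i - n + 1) X.2)

/-- The flag set `M` of the flat amalgamation: the orbit of the base flag `(Φ₀, Ψ₀)`
under the group generated by the maps `R_0, …, R_{m+n−2}` of the mix construction. -/
def mixM {F G : Type*} (n m : ℕ) (r : ℕ → F → F) (s : ℕ → G → G)
    (Φ₀ : F) (Ψ₀ : G) : Set (F × G) :=
  {X | SOrbit (mixR n r s) {c | c < m + n - 1} (Φ₀, Ψ₀) X}

/-- in the mix of an `n`-polytope `P = (F, r)` (base flag `Φ₀`) with an
`m`-polytope `Q = (G, s)` (base flag `Ψ₀`), the projection to `F`, restricted to the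
`{R_0, …, R_{n−1}}`-orbit of any flag of the mix, is a bijection onto `F` if and only
if `P` is facet-bipartite. -/
theorem mix_facets_iff_facetBipartite {F G : Type*} (n m : ℕ) (hn : 2 ≤ n) (hm : 2 ≤ m)
    (r : ℕ → F → F) (hP : IsPolytope n r) (Φ₀ : F)
    (s : ℕ → G → G) (hQ : IsPolytope m s) (Ψ₀ : G) :
    (∀ X ∈ mixM n m r s Φ₀ Ψ₀,
        Set.BijOn Prod.fst {Y | SOrbit (mixR n r s) {c | c < n} X Y} Set.univ) ↔
    (∃ c : F → ZMod 2,
        (∀ i ≤ n - 2, ∀ Λ, c (r i Λ) = c Λ) ∧ (∀ Λ, c (r (n - 1) Λ) = c Λ + 1)) := by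
  have R1 : ∀ i < n - 1, ∀ a b, mixR n r s i (a, b) = (r i a, b) := by
    intro i hi a b; simp [mixR, hi]
  have R2 : ∀ a b, mixR n r s (n - 1) (a, b) = (r (n - 1) a, s 0 b) := by
    intro a b; simp [mixR]
  have s0 := hQ.invol 0 (by omega)
  constructor
  · intro h
    have hb := h (Φ₀, Ψ₀) Relation.ReflTransGen.refl
    obtain ⟨-, hinj, hsurj⟩ := hb
    set O := {Y | SOrbit (mixR n r s) {c | c < n} (Φ₀, Ψ₀) Y} with hO
    have step : ∀ i < n, ∀ Y ∈ O, mixR n r s i Y ∈ O := by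
      intro i hi Y hY
      exact Relation.ReflTransGen.tail hY ⟨i, hi, rfl⟩
    have two : ∀ Y ∈ O, Y.2 = Ψ₀ ∨ Y.2 = s 0 Ψ₀ := by
      intro Y hY
      change Relation.ReflTransGen _ _ _ at hY
      induction hY with
      | refl => left; rfl
      | @tail b c hb hbc ih =>
        obtain ⟨i, hi, rfl⟩ := hbc
        obtain ⟨b1, b2⟩ := b
        change i < n at hi
        by_cases h1 : i < n - 1
        · rw [R1 i h1]; exact ih
        · obtain rfl : i = n - 1 := by omega
          rw [R2]
          rcases ih with h | h
          · right; exact congrArg (s 0) h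
          · left; change b2 = _ at h; change s 0 b2 = _; rw [h, s0]
    have ex : ∀ a, (a, Ψ₀) ∈ O ∨ (a, s 0 Ψ₀) ∈ O := by
      intro a
      obtain ⟨⟨y1, y2⟩, hY, rfl⟩ := hsurj (Set.mem_univ a)
      rcases two _ hY with h | h
      · left; change y2 = _ at h; subst h; exact hY
      · right; change y2 = _ at h; subst h; exact hY
    have un : ∀ a, (a, Ψ₀) ∈ O → (a, s 0 Ψ₀) ∈ O → False := by
      intro a h1 h2
      have := hinj h1 h2 rfl
      exact hQ.noFixedPoints 0 (by omega) Ψ₀ (congrArg Prod.snd this).symm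
    classical
    refine ⟨fun a => if (a, Ψ₀) ∈ O then 0 else 1, ?_, ?_⟩
    · intro i hi a
      have key : (r i a, Ψ₀) ∈ O ↔ (a, Ψ₀) ∈ O := by
        constructor
        · intro h
          have := step i (by omega) _ h
          rwa [R1 i (by omega), hP.invol i (by omega)] at this
        · intro h
          have := step i (by omega) _ h
          rwa [R1 i (by omega)] at this
      simp only [key]
    · intro a
      have key : (r (n - 1) a, Ψ₀) ∈ O ↔ ¬ (a, Ψ₀) ∈ O := by
        constructor
        · intro h h'
          have := step (n - 1) (by omega) _ h
          rw [R2, hP.invol (n - 1) (by omega)] at this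
          exact un a h' this
        · intro h
          have := step (n - 1) (by omega) _ ((ex a).resolve_left h)
          rwa [R2, s0] at this
      by_cases h : (a, Ψ₀) ∈ O
      · simp [key, h]
      · simp only [key, h, not_false_eq_true, if_true, if_false]; decide
  · rintro ⟨c, hc1, hc2⟩ X -
    have inv : ∀ Y, SOrbit (mixR n r s) {c | c < n} X Y →
        (c Y.1 = c X.1 ∧ Y.2 = X.2) ∨ (c Y.1 = c X.1 + 1 ∧ Y.2 = s 0 X.2) := by
      intro Y hY
      change Relation.ReflTransGen _ _ _ at hY
      induction hY with
      | refl => left; exact ⟨rfl, rfl⟩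
      | @tail b d hb hbd ih =>
        obtain ⟨i, hi, rfl⟩ := hbd
        obtain ⟨b1, b2⟩ := b
        change i < n at hi
        by_cases h1 : i < n - 1
        · rw [R1 i h1]
          simpa only [hc1 i (by omega)] using ih
        · obtain rfl : i = n - 1 := by omega
          rw [R2]
          simp only [hc2] at ih ⊢
          rcases ih with ⟨h, h'⟩ | ⟨h, h'⟩
          · right; rw [h, h']; exact ⟨rfl, rfl⟩
          · left; rw [h, h', s0, add_assoc]
            refine ⟨?_, rfl⟩
            rw [show (1 : ZMod 2) + 1 = 0 by decide, add_zero]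
    have ne : ∀ x : ZMod 2, x ≠ x + 1 := by decide
    refine ⟨fun _ _ => Set.mem_univ _, ?_, ?_⟩
    · rintro ⟨a, b⟩ hY ⟨a', b'⟩ hZ h
      change a = a' at h
      subst h
      rcases inv _ hY with ⟨h1, h2⟩ | ⟨h1, h2⟩ <;> rcases inv _ hZ with ⟨h3, h4⟩ | ⟨h3, h4⟩
      · exact Prod.ext rfl (h2.trans h4.symm)
      · exact absurd (h1.symm.trans h3) (ne _)
      · exact absurd (h3.symm.trans h1) (ne _)
      · exact Prod.ext rfl (h2.trans h4.symm)
    · intro a _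
      have ht := hP.transitive X.1 a
      change Relation.ReflTransGen _ _ _ at ht
      induction ht with
      | refl => exact ⟨X, Relation.ReflTransGen.refl, rfl⟩
      | @tail b d hb hbd ih =>
        obtain ⟨i, hi, rfl⟩ := hbd
        obtain ⟨⟨y1, y2⟩, hY, rfl⟩ := ih (Set.mem_univ _)
        change i < n at hi
        refine ⟨mixR n r s i (y1, y2), Relation.ReflTransGen.tail hY ⟨i, hi, rfl⟩, ?_⟩
        by_cases h1 : i < n - 1
        · rw [R1 i h1]
        · obtain rfl : i = n - 1 := by omega
          rw [R2]
end

section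
/- Let n, m ≥ 2, let P = (F, r) be an n-polytope with base flag Φ₀ and let Q = (G, s) be an m-polytope with base flag Ψ₀, and let M ⊆ F × G be the orbit of (Φ₀, Ψ₀) under the group generated by the maps R_0, …, R_{m+n−2} of the mix construction. Then the following are equivalent: (a) for every element X of M, the projection to G restricted to the orbit of X under the subgroup generated by {R_{n−1}, …, R_{m+n−2}} is a bijection onto G; (b) Q is vertex-bipartite, i.e. there is d : G → ZMod 2 with d(s_j Δ) = d(Δ) for 1 ≤ j ≤ m−1 and d(s_0 Δ) = d(Δ) + 1 for all Δ. -/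
/-- in the mix of an `n`-polytope `P = (F, r)` (base flag `Φ₀`) with an
`m`-polytope `Q = (G, s)` (base flag `Ψ₀`), the projection to `G`, restricted to the
`{R_{n−1}, …, R_{m+n−2}}`-orbit of any flag of the mix, is a bijection onto `G` if and
only if `Q` is vertex-bipartite. -/
theorem mix_cofaces_iff_vertexBipartite {F G : Type*} (n m : ℕ) (hn : 2 ≤ n) (hm : 2 ≤ m)
    (r : ℕ → F → F) (hP : IsPolytope n r) (Φ₀ : F)
    (s : ℕ → G → G) (hQ : IsPolytope m s) (Ψ₀ : G) :
    (∀ X ∈ mixM n m r s Φ₀ Ψ₀,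
        Set.BijOn Prod.snd
          {Y | SOrbit (mixR n r s) {c | n - 1 ≤ c ∧ c < m + n - 1} X Y} Set.univ) ↔
    (∃ d : G → ZMod 2,
        (∀ j, 1 ≤ j → j ≤ m - 1 → ∀ Δ, d (s j Δ) = d Δ) ∧
        (∀ Δ, d (s 0 Δ) = d Δ + 1)) := by
  have hstep0 : ∀ Λ Δ, mixR n r s (n - 1) (Λ, Δ) = (r (n - 1) Λ, s 0 Δ) := by
    intro Λ Δ
    simp [mixR]
  have hstepj : ∀ j, 1 ≤ j → ∀ Λ Δ, mixR n r s (j + n - 1) (Λ, Δ) = (Λ, s j Δ) := by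
    intro j hj Λ Δ
    have h1 : ¬ (j + n - 1 < n - 1) := by omega
    have h2 : ¬ (j + n - 1 = n - 1) := by omega
    have h3 : j + n - 1 - n + 1 = j := by omega
    simp only [mixR, h1, h2, if_false, h3]
  have hinv : ∀ A, r (n - 1) (r (n - 1) A) = A := hP.invol (n - 1) (by omega)
  have hne : ∀ A, r (n - 1) A ≠ A := hP.noFixedPoints (n - 1) (by omega)
  have ext0 : ∀ X Λ Δ, SOrbit (mixR n r s) {c | n - 1 ≤ c ∧ c < m + n - 1} X (Λ, Δ) →
      SOrbit (mixR n r s) {c | n - 1 ≤ c ∧ c < m + n - 1} X (r (n - 1) Λ, s 0 Δ) := by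
    intro X Λ Δ h
    exact Relation.ReflTransGen.tail h ⟨n - 1, ⟨le_refl _, by omega⟩, hstep0 Λ Δ⟩
  have extj : ∀ X Λ Δ j, 1 ≤ j → j < m →
      SOrbit (mixR n r s) {c | n - 1 ≤ c ∧ c < m + n - 1} X (Λ, Δ) →
      SOrbit (mixR n r s) {c | n - 1 ≤ c ∧ c < m + n - 1} X (Λ, s j Δ) := by
    intro X Λ Δ j h1 h2 h
    exact Relation.ReflTransGen.tail h
      ⟨j + n - 1, ⟨by omega, by omega⟩, hstepj j h1 Λ Δ⟩
  -- induction principle on cofacet orbits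
  have ind : ∀ (X : F × G) (p : F → G → Prop), p X.1 X.2 →
      (∀ Λ Δ, p Λ Δ → p (r (n - 1) Λ) (s 0 Δ)) →
      (∀ Λ Δ j, 1 ≤ j → j < m → p Λ Δ → p Λ (s j Δ)) →
      ∀ Y, SOrbit (mixR n r s) {c | n - 1 ≤ c ∧ c < m + n - 1} X Y → p Y.1 Y.2 := by
    intro X p h0 hs0 hsj Y hY
    unfold SOrbit at hY
    induction hY with
    | refl => exact h0
    | tail _ hbc ih =>
      rename_i b c _
      obtain ⟨i, ⟨hi1, hi2⟩, rfl⟩ := hbc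
      obtain ⟨Λ, Δ⟩ := b
      rcases Nat.eq_or_lt_of_le hi1 with h | h
      · rw [← h, hstep0]
        exact hs0 _ _ ih
      · obtain ⟨j, rfl⟩ : ∃ j, i = j + n - 1 := ⟨i - (n - 1), by omega⟩
        rw [hstepj j (by omega)]
        exact hsj _ _ j (by omega) (by omega) ih
  constructor
  · intro H
    have hB := H (Φ₀, Ψ₀) Relation.ReflTransGen.refl
    have uniq : ∀ Λ Λ' Δ,
        SOrbit (mixR n r s) {c | n - 1 ≤ c ∧ c < m + n - 1} (Φ₀, Ψ₀) (Λ, Δ) →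
        SOrbit (mixR n r s) {c | n - 1 ≤ c ∧ c < m + n - 1} (Φ₀, Ψ₀) (Λ', Δ) → Λ = Λ' := by
      intro Λ Λ' Δ h h'
      exact congrArg Prod.fst (hB.injOn h h' rfl)
    have ex : ∀ Δ, ∃ Λ,
        SOrbit (mixR n r s) {c | n - 1 ≤ c ∧ c < m + n - 1} (Φ₀, Ψ₀) (Λ, Δ) := by
      intro Δ
      obtain ⟨⟨Λ, Δ'⟩, h, h'⟩ := hB.surjOn (Set.mem_univ Δ)
      simp only at h'
      subst h'
      exact ⟨Λ, h⟩
    have two := ind (Φ₀, Ψ₀) (fun Λ _ => Λ = Φ₀ ∨ Λ = r (n - 1) Φ₀) (Or.inl rfl)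
      (by
        rintro Λ Δ (h | h)
        · right; rw [h]
        · left; rw [h, hinv])
      (fun _ _ _ _ _ h => h)
    choose f hf using ex
    classical
    refine ⟨fun Δ => if f Δ = Φ₀ then 0 else 1, ?_, ?_⟩
    · intro j h1 h2 Δ
      have : f (s j Δ) = f Δ := uniq _ _ _ (hf _) (extj _ _ _ j h1 (by omega) (hf Δ))
      simp only [this]
    · intro Δ
      have h : f (s 0 Δ) = r (n - 1) (f Δ) := uniq _ _ _ (hf _) (ext0 _ _ _ (hf Δ))
      rcases two _ (hf Δ) with h' | h'
      · simp only at h'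
        simp [h, h', hne]
      · simp only at h'
        simp only [h, h', hinv, hne, if_true, if_false]
        decide
  · rintro ⟨d, hdj, hd0⟩ ⟨A, B⟩ -
    have key := ind (A, B)
      (fun Λ Δ => (d Δ = d B ∧ Λ = A) ∨ (d Δ = d B + 1 ∧ Λ = r (n - 1) A))
      (Or.inl ⟨rfl, rfl⟩)
      (by
        rintro Λ Δ (⟨h, h'⟩ | ⟨h, h'⟩)
        · right; exact ⟨by rw [hd0, h], by rw [h']⟩
        · left
          refine ⟨?_, by rw [h', hinv]⟩
          rw [hd0, h, add_assoc, show (1 : ZMod 2) + 1 = 0 from by decide, add_zero])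
      (by
        intro Λ Δ j h1 h2 h
        simpa only [hdj j h1 (by omega)] using h)
    refine ⟨fun _ _ => Set.mem_univ _, ?_, ?_⟩
    · rintro ⟨L, D⟩ h ⟨L', D'⟩ h' e
      simp only at e
      subst e
      have hz : d B ≠ d B + 1 := by
        intro hc
        have : (1 : ZMod 2) = 0 := by simpa using hc
        exact absurd this (by decide)
      rcases key _ h with ⟨a, b⟩ | ⟨a, b⟩ <;> rcases key _ h' with ⟨a', b'⟩ | ⟨a', b'⟩
      · exact Prod.ext (b.trans b'.symm) rfl
      · exact absurd (a.symm.trans a') hz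
      · exact absurd (a'.symm.trans a) hz
      · exact Prod.ext (b.trans b'.symm) rfl
    · intro Δ _
      have ht := hQ.transitive B Δ
      suffices hL : ∃ Λ,
          SOrbit (mixR n r s) {c | n - 1 ≤ c ∧ c < m + n - 1} (A, B) (Λ, Δ) by
        obtain ⟨Λ, h⟩ := hL
        exact ⟨(Λ, Δ), h, rfl⟩
      unfold SOrbit at ht
      induction ht with
      | refl => exact ⟨A, Relation.ReflTransGen.refl⟩
      | tail _ hbc ih =>
        obtain ⟨i, hi, rfl⟩ := hbc
        obtain ⟨Λ, h⟩ := ih (Set.mem_univ _)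
        rcases Nat.eq_zero_or_pos i with h0 | h0
        · subst h0
          exact ⟨_, ext0 _ _ _ h⟩
        · exact ⟨_, extj _ _ _ i h0 hi h⟩
end

section
/- Let n, m ≥ 2, let P = (F, r) be a facet-bipartite n-polytope with coloring c and base flag Φ₀ satisfying c(Φ₀) = 0, and let Q = (G, s) be a vertex-bipartite m-polytope with coloring d and base flag Ψ₀ satisfying d(Ψ₀) = 0. Let M be the flag set of the flat amalgamation P|Q. Then M = {(Λ, Δ) ∈ F × G : c(Λ) = d(Δ)}. Moreover, if F and G are finite, then 2·|M| = |F|·|G|. -/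
theorem sOrbit_inv {F G : Type*} (n m : ℕ) (hn : 2 ≤ n)
    (r : ℕ → F → F) (c : F → ZMod 2)
    (hc : (∀ i ≤ n - 2, ∀ Λ, c (r i Λ) = c Λ) ∧ (∀ Λ, c (r (n - 1) Λ) = c Λ + 1))
    (s : ℕ → G → G) (d : G → ZMod 2)
    (hd : (∀ j, 1 ≤ j → j ≤ m - 1 → ∀ Δ, d (s j Δ) = d Δ) ∧ (∀ Δ, d (s 0 Δ) = d Δ + 1))
    (X Y : F × G) (hX : c X.1 = d X.2)
    (h : SOrbit (mixR n r s) {c | c < m + n - 1} X Y) : c Y.1 = d Y.2 := by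
  unfold SOrbit at h
  induction h with
  | refl => exact hX
  | tail _ h ih =>
    obtain ⟨i, hi, rfl⟩ := h
    simp only [Set.mem_setOf_eq] at hi
    unfold mixR
    split_ifs with h1 h2
    · simpa [hc.1 i (by omega)] using ih
    · simp [hc.2, hd.2, ih]
    · simpa [hd.1 (i - n + 1) (by omega) (by omega)] using ih

theorem sOrbit_left {F G : Type*} (n m : ℕ) (hn : 2 ≤ n) (hm : 2 ≤ m)
    (r : ℕ → F → F) (s : ℕ → G → G) (Φ Λ : F) (Ψ : G)
    (h : SOrbit r {c | c < n} Φ Λ) :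
    ∃ Ψ', SOrbit (mixR n r s) {c | c < m + n - 1} (Φ, Ψ) (Λ, Ψ') := by
  unfold SOrbit at h
  induction h with
  | refl => exact ⟨Ψ, Relation.ReflTransGen.refl⟩
  | tail _ h ih =>
    obtain ⟨i, hi, rfl⟩ := h
    simp only [Set.mem_setOf_eq] at hi
    obtain ⟨Ψ', h'⟩ := ih
    by_cases h1 : i < n - 1
    · exact ⟨Ψ', h'.tail ⟨i, by simp only [Set.mem_setOf_eq]; omega, by simp [mixR, h1]⟩⟩
    · obtain rfl : i = n - 1 := by omega
      exact ⟨s 0 Ψ', h'.tail ⟨n - 1, by simp only [Set.mem_setOf_eq]; omega, by simp [mixR]⟩⟩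

theorem sOrbit_right {F G : Type*} (n m : ℕ) (hn : 2 ≤ n) (hm : 2 ≤ m)
    (r : ℕ → F → F) (hr : ∀ Λ, r (n - 1) (r (n - 1) Λ) = Λ) (s : ℕ → G → G)
    (Λ : F) (Ψ Δ : G)
    (h : SOrbit s {c | c < m} Ψ Δ) :
    ∃ Λ', (Λ' = Λ ∨ Λ' = r (n - 1) Λ) ∧
      SOrbit (mixR n r s) {c | c < m + n - 1} (Λ, Ψ) (Λ', Δ) := by
  unfold SOrbit at h
  induction h with
  | refl => exact ⟨Λ, Or.inl rfl, Relation.ReflTransGen.refl⟩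
  | tail _ h ih =>
    obtain ⟨i, hi, rfl⟩ := h
    simp only [Set.mem_setOf_eq] at hi
    obtain ⟨Λ', h0, h'⟩ := ih
    by_cases h1 : i = 0
    · subst h1
      refine ⟨r (n - 1) Λ', ?_, h'.tail ⟨n - 1, by simp only [Set.mem_setOf_eq]; omega, by simp [mixR]⟩⟩
      rcases h0 with rfl | rfl
      · exact Or.inr rfl
      · exact Or.inl (hr _)
    · refine ⟨Λ', h0, h'.tail ⟨i + n - 1, by simp only [Set.mem_setOf_eq]; omega, ?_⟩⟩
      have e1 : ¬ (i + n - 1 < n - 1) := by omega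
      have e2 : ¬ (i + n - 1 = n - 1) := by omega
      have e3 : i + n - 1 - n + 1 = i := by omega
      simp only [mixR, e1, e2, e3, if_false]

/-- for a facet-bipartite `n`-polytope `P` (coloring `c`, base flag `Φ₀`
with `c(Φ₀) = 0`) and a vertex-bipartite `m`-polytope `Q` (coloring `d`, base flag
`Ψ₀` with `d(Ψ₀) = 0`), the flag set `M` of the flat amalgamation `P|Q` is exactly
`{(Λ, Δ) : c(Λ) = d(Δ)}`; moreover, if `F` and `G` are finite then
`2·|M| = |F|·|G|`. -/
theorem flatAmalg_flags {F G : Type*} (n m : ℕ) (hn : 2 ≤ n) (hm : 2 ≤ m)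
    (r : ℕ → F → F) (hP : IsPolytope n r)
    (c : F → ZMod 2)
    (hc : (∀ i ≤ n - 2, ∀ Λ, c (r i Λ) = c Λ) ∧ (∀ Λ, c (r (n - 1) Λ) = c Λ + 1))
    (Φ₀ : F) (hΦ₀ : c Φ₀ = 0)
    (s : ℕ → G → G) (hQ : IsPolytope m s)
    (d : G → ZMod 2)
    (hd : (∀ j, 1 ≤ j → j ≤ m - 1 → ∀ Δ, d (s j Δ) = d Δ) ∧ (∀ Δ, d (s 0 Δ) = d Δ + 1))
    (Ψ₀ : G) (hΨ₀ : d Ψ₀ = 0) :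
    (∀ X : F × G, X ∈ mixM n m r s Φ₀ Ψ₀ ↔ c X.1 = d X.2) ∧
    (Finite F → Finite G →
      2 * Nat.card (mixM n m r s Φ₀ Ψ₀) = Nat.card F * Nat.card G) := by
  have hr := hP.invol (n - 1) (by omega)
  have key : ∀ X : F × G, X ∈ mixM n m r s Φ₀ Ψ₀ ↔ c X.1 = d X.2 := by
    rintro ⟨Λ, Δ⟩
    constructor
    · intro h
      exact sOrbit_inv n m hn r c hc s d hd (Φ₀, Ψ₀) _ (by simp [hΦ₀, hΨ₀]) h
    · intro h
      obtain ⟨Ψ', h1⟩ := sOrbit_left n m hn hm r s Φ₀ Λ Ψ₀ (hP.transitive _ _)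
      obtain ⟨Λ', h0, h2⟩ := sOrbit_right n m hn hm r hr s Λ Ψ' Δ (hQ.transitive _ _)
      have h3 := Relation.ReflTransGen.trans h1 h2
      have h4 := sOrbit_inv n m hn r c hc s d hd (Φ₀, Ψ₀) _ (by simp [hΦ₀, hΨ₀]) h3
      rcases h0 with rfl | rfl
      · exact h3
      · simp only [hc.2] at h4 h
        rw [← h] at h4
        simp at h4
  refine ⟨key, fun _ _ => ?_⟩
  have hz : ∀ a b : ZMod 2, a + 1 = b ↔ a ≠ b := by decide
  have hcompl : Nat.card (mixM n m r s Φ₀ Ψ₀) =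
      Nat.card ((mixM n m r s Φ₀ Ψ₀)ᶜ : Set (F × G)) := by
    let e : F × G ≃ F × G :=
      ⟨fun X => (r (n - 1) X.1, X.2), fun X => (r (n - 1) X.1, X.2),
        fun X => by simp [hr], fun X => by simp [hr]⟩
    refine Nat.card_congr (e.subtypeEquiv fun X => ?_)
    change X ∈ mixM n m r s Φ₀ Ψ₀ ↔ ¬ (e X ∈ mixM n m r s Φ₀ Ψ₀)
    rw [key, key]
    change c X.1 = d X.2 ↔ ¬ (c (r (n - 1) X.1) = d X.2)
    rw [hc.2, hz, not_not]
  have := Set.ncard_add_ncard_compl (mixM n m r s Φ₀ Ψ₀)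
  rw [Nat.card_prod, ← Nat.card_coe_set_eq, ← Nat.card_coe_set_eq, ← hcompl] at this
  omega
end

section
/- Let n, m ≥ 2, let P = (F, r) be a facet-bipartite n-polytope with coloring c and base flag Φ₀ satisfying c(Φ₀) = 0, and let Q = (G, s) be a vertex-bipartite m-polytope with coloring d and base flag Ψ₀ satisfying d(Ψ₀) = 0. Then the flat amalgamation P|Q is (n−2,n)-flat as a rank-(m+n−1) structure: for all flags X, Y in its flag set M, the orbit of X under the subgroup generated by {R_i : 0 ≤ i ≤ m+n−2, i ≠ n−2} meets the orbit of Y under the subgroup generated by {R_i : 0 ≤ i ≤ m+n−2, i ≠ n}. -/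
theorem mix_inv {F G : Type*} (n m : ℕ) (hn : 2 ≤ n) (hm : 2 ≤ m)
    (r : ℕ → F → F) (c : F → ZMod 2)
    (hc : (∀ i ≤ n - 2, ∀ Λ, c (r i Λ) = c Λ) ∧ (∀ Λ, c (r (n - 1) Λ) = c Λ + 1))
    (s : ℕ → G → G) (d : G → ZMod 2)
    (hd : (∀ j, 1 ≤ j → j ≤ m - 1 → ∀ Δ, d (s j Δ) = d Δ) ∧ (∀ Δ, d (s 0 Δ) = d Δ + 1))
    (S : Set ℕ) (hS : ∀ i ∈ S, i < m + n - 1)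
    (X Y : F × G) (h : SOrbit (mixR n r s) S X Y) (hX : c X.1 = d X.2) : c Y.1 = d Y.2 := by
  unfold SOrbit at h
  induction h with
  | refl => exact hX
  | tail _ h2 ih =>
    obtain ⟨i, hi, rfl⟩ := h2
    have hi' := hS i hi
    unfold mixR
    split_ifs with h1 h2
    · simp only
      rw [hc.1 i (by omega), ih]
    · simp only
      rw [hc.2, hd.2, ih]
    · simp only
      rw [hd.1 (i - n + 1) (by omega) (by omega), ih]

theorem mix_right {F G : Type*} (n m : ℕ) (hn : 2 ≤ n) (hm : 2 ≤ m)
    (r : ℕ → F → F) (hP : IsPolytope n r) (s : ℕ → G → G) (Λ : F) (Δ Δ' : G)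
    (h : SOrbit s {c | c < m} Δ Δ') :
    ∃ Λ', SOrbit (mixR n r s) ({c | c < m + n - 1} \ {n - 2}) (Λ, Δ) (Λ', Δ') := by
  unfold SOrbit at h
  induction h with
  | refl => exact ⟨Λ, Relation.ReflTransGen.refl⟩
  | tail _ h2 ih =>
    obtain ⟨i, hi, rfl⟩ := h2
    obtain ⟨Λ', hΛ⟩ := ih
    simp only [Set.mem_setOf_eq] at hi
    have hmem : i + (n - 1) ∈ ({c | c < m + n - 1} \ {n - 2} : Set ℕ) := by
      simp only [Set.mem_diff, Set.mem_setOf_eq, Set.mem_singleton_iff]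
      omega
    by_cases h0 : i = 0
    · subst h0
      refine ⟨r (n - 1) Λ', hΛ.tail ⟨_, hmem, ?_⟩⟩
      simp [mixR]
    · refine ⟨Λ', hΛ.tail ⟨_, hmem, ?_⟩⟩
      have e : i + (n - 1) - n + 1 = i := by omega
      simp [mixR, h0, e]

theorem mix_left {F G : Type*} (n m : ℕ) (hn : 2 ≤ n) (hm : 2 ≤ m)
    (r : ℕ → F → F) (s : ℕ → G → G) (hQ : IsPolytope m s) (Λ Λ' : F) (Δ : G)
    (h : SOrbit r {c | c < n} Λ Λ') :
    ∃ Δ', (Δ' = Δ ∨ Δ' = s 0 Δ) ∧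
      SOrbit (mixR n r s) ({c | c < m + n - 1} \ {n}) (Λ, Δ) (Λ', Δ') := by
  unfold SOrbit at h
  induction h with
  | refl => exact ⟨Δ, Or.inl rfl, Relation.ReflTransGen.refl⟩
  | tail _ h2 ih =>
    obtain ⟨i, hi, rfl⟩ := h2
    obtain ⟨Δ', ho, hΔ⟩ := ih
    simp only [Set.mem_setOf_eq] at hi
    have hmem : i ∈ ({c | c < m + n - 1} \ {n} : Set ℕ) := by
      simp only [Set.mem_diff, Set.mem_setOf_eq, Set.mem_singleton_iff]
      omega
    by_cases h0 : i = n - 1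
    · refine ⟨s 0 Δ', ?_, hΔ.tail ⟨_, hmem, ?_⟩⟩
      · rcases ho with rfl | rfl
        · exact Or.inr rfl
        · exact Or.inl (hQ.invol 0 (by omega) _)
      · simp [mixR, h0]
    · refine ⟨Δ', ho, hΔ.tail ⟨_, hmem, ?_⟩⟩
      have e : i < n - 1 := by omega
      simp [mixR, e]

/-- the flat amalgamation `P|Q` of a facet-bipartite `n`-polytope `P`
and a vertex-bipartite `m`-polytope `Q` is `(n−2, n)`-flat as a rank-`(m+n−1)`
structure: for all flags `X, Y` of `P|Q`, the orbit of `X` under the maps `R_i`,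
`i ≠ n−2`, meets the orbit of `Y` under the maps `R_i`, `i ≠ n`. -/
theorem flatAmalg_isFlat {F G : Type*} (n m : ℕ) (hn : 2 ≤ n) (hm : 2 ≤ m)
    (r : ℕ → F → F) (hP : IsPolytope n r)
    (c : F → ZMod 2)
    (hc : (∀ i ≤ n - 2, ∀ Λ, c (r i Λ) = c Λ) ∧ (∀ Λ, c (r (n - 1) Λ) = c Λ + 1))
    (Φ₀ : F) (hΦ₀ : c Φ₀ = 0)
    (s : ℕ → G → G) (hQ : IsPolytope m s)
    (d : G → ZMod 2)
    (hd : (∀ j, 1 ≤ j → j ≤ m - 1 → ∀ Δ, d (s j Δ) = d Δ) ∧ (∀ Δ, d (s 0 Δ) = d Δ + 1))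
    (Ψ₀ : G) (hΨ₀ : d Ψ₀ = 0) :
    ∀ X ∈ mixM n m r s Φ₀ Ψ₀, ∀ Y ∈ mixM n m r s Φ₀ Ψ₀,
      ∃ Z, SOrbit (mixR n r s) ({c | c < m + n - 1} \ {n - 2}) X Z ∧
        SOrbit (mixR n r s) ({c | c < m + n - 1} \ {n}) Y Z := by
  rintro ⟨Λ, Δ⟩ hX ⟨Λ', Δ'⟩ hY
  have hb : c (Φ₀, Ψ₀).1 = d (Φ₀, Ψ₀).2 := by simp [hΦ₀, hΨ₀]
  have iX := mix_inv n m hn hm r c hc s d hd _ (fun i hi => hi) _ _ hX hb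
  have iY := mix_inv n m hn hm r c hc s d hd _ (fun i hi => hi) _ _ hY hb
  obtain ⟨Λ₁, h1⟩ := mix_right n m hn hm r hP s Λ Δ Δ' (hQ.transitive _ _)
  obtain ⟨Δ₁, ho, h2⟩ := mix_left n m hn hm r s hQ Λ' Λ₁ Δ' (hP.transitive _ _)
  have i1 := mix_inv n m hn hm r c hc s d hd _ (fun i hi => hi.1) _ _ h1 iX
  have i2 := mix_inv n m hn hm r c hc s d hd _ (fun i hi => hi.1) _ _ h2 iY
  rcases ho with rfl | rfl
  · exact ⟨_, h1, h2⟩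
  · exfalso
    simp only at i1 i2
    rw [i1, hd.2] at i2
    simp at i2
end

section
/- Let n, m ≥ 2, let P = (F, r) be a facet-bipartite n-polytope with coloring c and base flag Φ₀ satisfying c(Φ₀) = 0, and let Q = (G, s) be a vertex-bipartite m-polytope with coloring d and base flag Ψ₀ satisfying d(Ψ₀) = 0. Then the flat amalgamation P|Q, with flag set M and the restricted maps R_0, …, R_{m+n−2}, is an (m+n−1)-polytope: each restricted R_i is a fixed-point-free involution of M, R_i and R_j commute on M whenever |i−j| > 1, the group generated by the restricted R_0, …, R_{m+n−2} acts transitively on M, and the Path Intersection Property holds (for all X, Y ∈ M and 0 ≤ i < j ≤ m+n−2, if Y is in the orbit of X under ⟨R_i, …, R_{m+n−2}⟩ and under ⟨R_0, …, R_j⟩, then Y is in the orbit of X under ⟨R_i, …, R_j⟩). -/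
theorem SOrbit.project {F G : Type*} {r : ℕ → F → F} {R : ℕ → G → G} {S T : Set ℕ} (f : G → F)
    (h : ∀ i ∈ S, ∀ x, f (R i x) = f x ∨ ∃ k ∈ T, r k (f x) = f (R i x)) {X Y : G}
    (hXY : SOrbit R S X Y) : SOrbit r T (f X) (f Y) := by
  induction hXY with
  | refl => exact Relation.ReflTransGen.refl
  | tail _ hb ih =>
    obtain ⟨i, hi, rfl⟩ := hb
    rcases h i hi _ with h1 | ⟨k, hk, h1⟩
    · rw [h1]; exact ih
    · exact Relation.ReflTransGen.tail ih ⟨k, hk, h1⟩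

theorem SOrbit.inv_of {F α : Type*} {r : ℕ → F → F} {S : Set ℕ} (f : F → α)
    (h : ∀ i ∈ S, ∀ x, f (r i x) = f x) {X Y : F} (hXY : SOrbit r S X Y) : f Y = f X := by
  induction hXY with
  | refl => rfl
  | tail _ hb ih =>
    obtain ⟨i, hi, rfl⟩ := hb
    rw [h i hi, ih]

theorem SOrbit.reverse {F : Type*} {r : ℕ → F → F} {S : Set ℕ}
    (h : ∀ i ∈ S, ∀ x, r i (r i x) = x) {X Y : F} (hXY : SOrbit r S X Y) : SOrbit r S Y X := by
  induction hXY with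
  | refl => exact Relation.ReflTransGen.refl
  | tail _ hb ih =>
    obtain ⟨i, hi, rfl⟩ := hb
    exact Relation.ReflTransGen.head ⟨i, hi, h i hi _⟩ ih

theorem mixR_lt {F G : Type*} {n : ℕ} {r : ℕ → F → F} {s : ℕ → G → G} {i : ℕ} (h : i < n - 1)
    (X : F × G) : mixR n r s i X = (r i X.1, X.2) := by
  simp [mixR, h]

theorem mixR_mid {F G : Type*} {n : ℕ} {r : ℕ → F → F} {s : ℕ → G → G}
    (X : F × G) : mixR n r s (n - 1) X = (r (n - 1) X.1, s 0 X.2) := by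
  simp [mixR]

theorem mixR_gt {F G : Type*} {n : ℕ} {r : ℕ → F → F} {s : ℕ → G → G} {i : ℕ} (h : n - 1 < i)
    (X : F × G) : mixR n r s i X = (X.1, s (i - n + 1) X.2) := by
  have h1 : ¬ i < n - 1 := by omega
  have h2 : ¬ i = n - 1 := by omega
  simp [mixR, h1, h2]

theorem mixR_invol {F G : Type*} {n m : ℕ} (hn : 2 ≤ n) (hm : 2 ≤ m)
    {r : ℕ → F → F} (hP : IsPolytope n r) {s : ℕ → G → G} (hQ : IsPolytope m s)
    (i : ℕ) (hi : i < m + n - 1) (X : F × G) : mixR n r s i (mixR n r s i X) = X := by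
  rcases lt_trichotomy i (n - 1) with h | rfl | h
  · simp only [mixR_lt h]
    rw [hP.invol i (by omega)]
  · simp only [mixR_mid]
    rw [hP.invol _ (by omega), hQ.invol _ (by omega)]
  · simp only [mixR_gt h]
    rw [hQ.invol _ (by omega)]

theorem mix_lift_left {F G : Type*} {n : ℕ}
    {r : ℕ → F → F} {s : ℕ → G → G} (hs : ∀ x, s 0 (s 0 x) = x) {S T : Set ℕ}
    (hS : ∀ i ∈ T, i ∈ S ∧ i ≤ n - 1)
    {Λ Λ' : F} (Δ : G) (h : SOrbit r T Λ Λ') :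
    ∃ Δ', (Δ' = Δ ∨ Δ' = s 0 Δ) ∧ SOrbit (mixR n r s) S (Λ, Δ) (Λ', Δ') := by
  induction h with
  | refl => exact ⟨Δ, Or.inl rfl, Relation.ReflTransGen.refl⟩
  | tail _ hb ih =>
    obtain ⟨i, hi, rfl⟩ := hb
    obtain ⟨Δ', h1, h2⟩ := ih
    obtain ⟨hiS, hin⟩ := hS i hi
    rcases hin.lt_or_eq with h | rfl
    · exact ⟨Δ', h1, Relation.ReflTransGen.tail h2 ⟨i, hiS, mixR_lt h _⟩⟩
    · refine ⟨s 0 Δ', ?_, Relation.ReflTransGen.tail h2 ⟨_, hiS, mixR_mid _⟩⟩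
      rcases h1 with rfl | rfl
      · exact Or.inr rfl
      · exact Or.inl (hs _)

theorem mix_lift_right {F G : Type*} {n : ℕ} (hn : 2 ≤ n)
    {r : ℕ → F → F} {s : ℕ → G → G} (hr : ∀ x, r (n - 1) (r (n - 1) x) = x) {S T : Set ℕ}
    (hS : ∀ i ∈ T, i + (n - 1) ∈ S)
    (Λ : F) {Δ Δ' : G} (h : SOrbit s T Δ Δ') :
    ∃ Λ', (Λ' = Λ ∨ Λ' = r (n - 1) Λ) ∧ SOrbit (mixR n r s) S (Λ, Δ) (Λ', Δ') := by
  induction h with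
  | refl => exact ⟨Λ, Or.inl rfl, Relation.ReflTransGen.refl⟩
  | tail _ hb ih =>
    obtain ⟨i, hi, rfl⟩ := hb
    obtain ⟨Λ', h1, h2⟩ := ih
    have hiS := hS i hi
    rcases Nat.eq_zero_or_pos i with rfl | h
    · rw [Nat.zero_add] at hiS
      refine ⟨r (n - 1) Λ', ?_, Relation.ReflTransGen.tail h2 ⟨_, hiS, mixR_mid _⟩⟩
      rcases h1 with rfl | rfl
      · exact Or.inr rfl
      · exact Or.inl (hr _)
    · refine ⟨Λ', h1, Relation.ReflTransGen.tail h2 ⟨_, hiS, ?_⟩⟩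
      rw [mixR_gt (by omega)]
      have : i + (n - 1) - n + 1 = i := by omega
      rw [this]

/-- the flat amalgamation `P|Q` of a facet-bipartite `n`-polytope `P`
and a vertex-bipartite `m`-polytope `Q`, with flag set `M = mixM n m r s Φ₀ Ψ₀` and
the restricted maps `R_0, …, R_{m+n−2}`, is an `(m+n−1)`-polytope: each `R_i` is a
fixed-point-free involution of `M`, far-apart `R_i, R_j` commute on `M`, the generated
group acts transitively on `M`, and the Path Intersection Property holds on `M`. -/
theorem flatAmalg_isPolytope {F G : Type*} (n m : ℕ) (hn : 2 ≤ n) (hm : 2 ≤ m)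
    (r : ℕ → F → F) (hP : IsPolytope n r)
    (c : F → ZMod 2)
    (hc : (∀ i ≤ n - 2, ∀ Λ, c (r i Λ) = c Λ) ∧ (∀ Λ, c (r (n - 1) Λ) = c Λ + 1))
    (Φ₀ : F) (hΦ₀ : c Φ₀ = 0)
    (s : ℕ → G → G) (hQ : IsPolytope m s)
    (d : G → ZMod 2)
    (hd : (∀ j, 1 ≤ j → j ≤ m - 1 → ∀ Δ, d (s j Δ) = d Δ) ∧ (∀ Δ, d (s 0 Δ) = d Δ + 1))
    (Ψ₀ : G) (hΨ₀ : d Ψ₀ = 0) :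
    (Φ₀, Ψ₀) ∈ mixM n m r s Φ₀ Ψ₀ ∧
    (∀ i < m + n - 1, ∀ X ∈ mixM n m r s Φ₀ Ψ₀,
      mixR n r s i X ∈ mixM n m r s Φ₀ Ψ₀ ∧
      mixR n r s i (mixR n r s i X) = X ∧ mixR n r s i X ≠ X) ∧
    (∀ i < m + n - 1, ∀ j < m + n - 1, i + 1 < j → ∀ X ∈ mixM n m r s Φ₀ Ψ₀,
      mixR n r s i (mixR n r s j X) = mixR n r s j (mixR n r s i X)) ∧
    (∀ X ∈ mixM n m r s Φ₀ Ψ₀, ∀ Y ∈ mixM n m r s Φ₀ Ψ₀,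
      SOrbit (mixR n r s) {c | c < m + n - 1} X Y) ∧
    (∀ i j, i < j → j < m + n - 1 → ∀ X ∈ mixM n m r s Φ₀ Ψ₀, ∀ Y ∈ mixM n m r s Φ₀ Ψ₀,
      SOrbit (mixR n r s) {c | i ≤ c ∧ c < m + n - 1} X Y →
      SOrbit (mixR n r s) {c | c ≤ j} X Y →
      SOrbit (mixR n r s) {c | i ≤ c ∧ c ≤ j} X Y) := by
  have hinv := mixR_invol hn hm hP hQ
  have hcd : ∀ i < m + n - 1, ∀ X : F × G,
      c (mixR n r s i X).1 + d (mixR n r s i X).2 = c X.1 + d X.2 := by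
    intro i hi X
    rcases lt_trichotomy i (n - 1) with h | rfl | h
    · rw [mixR_lt h]; simp only; rw [hc.1 i (by omega)]
    · rw [mixR_mid]; simp only; rw [hc.2, hd.2]
      have : (1 : ZMod 2) + 1 = 0 := by decide
      linear_combination this
    · rw [mixR_gt h]; simp only; rw [hd.1 _ (by omega) (by omega)]
  have hfst : ∀ i k, k ≤ m + n - 1 → ∀ X Y : F × G,
      SOrbit (mixR n r s) {c | i ≤ c ∧ c < k} X Y →
      SOrbit r {c | i ≤ c ∧ c < n ∧ c < k} X.1 Y.1 := by
    intro i k hk X Y h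
    refine SOrbit.project (f := Prod.fst) ?_ h
    rintro a ⟨ha, hak⟩ x
    rcases lt_trichotomy a (n - 1) with h | rfl | h
    · rw [mixR_lt h]; exact Or.inr ⟨a, ⟨ha, by omega, hak⟩, rfl⟩
    · rw [mixR_mid]; exact Or.inr ⟨n - 1, ⟨ha, by omega, hak⟩, rfl⟩
    · rw [mixR_gt h]; exact Or.inl rfl
  have hsnd : ∀ i k, k ≤ m + n - 1 → ∀ X Y : F × G,
      SOrbit (mixR n r s) {c | i ≤ c ∧ c < k} X Y →
      SOrbit s {c | i ≤ c + (n - 1) ∧ c + (n - 1) < k} X.2 Y.2 := by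
    intro i k hk X Y h
    refine SOrbit.project (f := Prod.snd) ?_ h
    rintro a ⟨ha, hak⟩ x
    rcases lt_trichotomy a (n - 1) with h | rfl | h
    · rw [mixR_lt h]; exact Or.inl rfl
    · rw [mixR_mid]
      exact Or.inr ⟨0, ⟨by omega, by omega⟩, rfl⟩
    · rw [mixR_gt h]
      exact Or.inr ⟨a - n + 1, ⟨by omega, by omega⟩, rfl⟩
  have hr1 := hP.invol (n - 1) (by omega)
  have hs0 := hQ.invol 0 (by omega)
  have hne : ∀ a : ZMod 2, a + 1 ≠ a := by decide
  refine ⟨Relation.ReflTransGen.refl, ?_, ?_, ?_, ?_⟩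
  · intro i hi X hX
    refine ⟨Relation.ReflTransGen.tail hX ⟨i, hi, rfl⟩, hinv i hi X, ?_⟩
    intro he
    rcases lt_trichotomy i (n - 1) with h | rfl | h
    · rw [mixR_lt h] at he
      exact hP.noFixedPoints i (by omega) _ (congrArg Prod.fst he)
    · rw [mixR_mid] at he
      exact hP.noFixedPoints _ (by omega) _ (congrArg Prod.fst he)
    · rw [mixR_gt h] at he
      exact hQ.noFixedPoints _ (by omega) _ (congrArg Prod.snd he)
  · intro i hi j hj hij X _
    rcases lt_trichotomy i (n - 1) with h | rfl | h
    · rcases lt_trichotomy j (n - 1) with h' | rfl | h'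
      · simp only [mixR_lt h, mixR_lt h']
        rw [hP.commute i (by omega) j (by omega) hij]
      · simp only [mixR_lt h, mixR_mid]
        rw [hP.commute i (by omega) _ (by omega) hij]
      · simp only [mixR_lt h, mixR_gt h']
    · have h' : n - 1 < j := by omega
      simp only [mixR_mid, mixR_gt h']
      rw [hQ.commute 0 (by omega) _ (by omega) (by omega)]
    · have h' : n - 1 < j := by omega
      simp only [mixR_gt h, mixR_gt h']
      rw [hQ.commute _ (by omega) _ (by omega) (by omega)]
  · intro X hX Y hY
    exact Relation.ReflTransGen.trans (SOrbit.reverse (fun i hi x => hinv i hi x) hX) hY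
  · intro i j hij hj X hX Y hY h1 h2
    have e2 : {c : ℕ | c ≤ j} = {c | 0 ≤ c ∧ c < j + 1} := by
      ext a; simp only [Set.mem_setOf_eq]; omega
    rw [e2] at h2
    have f1 := hfst _ _ le_rfl _ _ h1
    have g1 := hsnd _ _ le_rfl _ _ h1
    have f2 := hfst _ _ (by omega) _ _ h2
    have g2 := hsnd _ _ (by omega) _ _ h2
    have hXY : c Y.1 + d Y.2 = c X.1 + d X.2 :=
      SOrbit.inv_of (fun X : F × G => c X.1 + d X.2) (fun a ha x => hcd a ha.2 x) h1
    have hX0 : c X.1 + d X.2 = c Φ₀ + d Ψ₀ :=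
      SOrbit.inv_of (fun X : F × G => c X.1 + d X.2) (fun a ha x => hcd a ha x) hX
    obtain ⟨Λ, Δ⟩ := X
    obtain ⟨Λ', Δ'⟩ := Y
    simp only at f1 f2 g1 g2 hXY hX0
    by_cases hi : n ≤ i
    · have hΛ : Λ' = Λ := SOrbit.inv_of id (fun a ha x => by
        have := ha.1; have := ha.2.1; omega) f1
      subst hΛ
      have g := hQ.pip (i - n + 1) (j - n + 1) (by omega) (by omega) Δ Δ'
        (by convert g1 using 1; ext a; simp only [Set.mem_setOf_eq]; omega)
        (by convert g2 using 1; ext a; simp only [Set.mem_setOf_eq]; omega)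
      have key : SOrbit (mixR n r s) {c | i ≤ c ∧ c ≤ j} (Λ', Δ) (Λ', Δ') := by
        refine SOrbit.project (f := fun x : G => (Λ', x)) ?_ g
        rintro a ⟨ha, haj⟩ x
        refine Or.inr ⟨a + (n - 1), ⟨by omega, by omega⟩, ?_⟩
        rw [mixR_gt (by omega)]
        have : a + (n - 1) - n + 1 = a := by omega
        rw [this]
      exact key
    by_cases hjn : j < n - 1
    · have hΔ : Δ' = Δ := SOrbit.inv_of id (fun a ha x => by
        have := ha.2; omega) g2
      subst hΔ
      have g := hP.pip i j hij (by omega) Λ Λ'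
        (by convert f1 using 1; ext a; simp only [Set.mem_setOf_eq]; omega)
        (by convert f2 using 1; ext a; simp only [Set.mem_setOf_eq]; omega)
      have key : SOrbit (mixR n r s) {c | i ≤ c ∧ c ≤ j} (Λ, Δ') (Λ', Δ') := by
        refine SOrbit.project (f := fun x : F => (x, Δ')) ?_ g
        rintro a ⟨ha, haj⟩ x
        exact Or.inr ⟨a, ⟨ha, haj⟩, mixR_lt (by omega) _⟩
      exact key
    obtain ⟨Δ₁, hΔ₁, p1⟩ := mix_lift_left (n := n) hs0 (S := {c | i ≤ c ∧ c ≤ j})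
      (fun a ha => by
        have := ha.1; have := ha.2.1
        exact ⟨⟨by omega, by omega⟩, by omega⟩) Δ f1
    have q : SOrbit s {c | 0 ≤ c + (n - 1) ∧ c + (n - 1) < j + 1} Δ₁ Δ' := by
      rcases hΔ₁ with rfl | rfl
      · exact g2
      · exact Relation.ReflTransGen.head ⟨0, ⟨by omega, by omega⟩, hs0 _⟩ g2
    obtain ⟨Λ₁, hΛ₁, p2⟩ := mix_lift_right hn hr1 (S := {c | i ≤ c ∧ c ≤ j})
      (fun a ha => by
        have := ha.2
        exact ⟨by omega, by omega⟩) Λ' q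
    have p := Relation.ReflTransGen.trans p1 p2
    have hp : c Λ₁ + d Δ' = c Λ + d Δ :=
      SOrbit.inv_of (fun X : F × G => c X.1 + d X.2)
        (fun a ha x => hcd a (by have := ha.2; omega) x) p
    rcases hΛ₁ with rfl | rfl
    · exact p
    · exfalso
      rw [hc.2, ← hXY] at hp
      exact hne _ (add_right_cancel hp)
end
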